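/- arXiv:1312.7426 — 3 statements merged into one kernel-verified Lean document; each statement's English description precedes it below -/
import Mathlib

section
/- Let n ≥ 3 and let D be a dendrite whose set of endpoints End(D) is dense in D and such that every branch point of D has order exactly n (i.e., for every p ∈ D, the set D \ {p} has either at most 2 or exactly n connected components). Then there exists a mixing continuous map f : D → D such that every branch point of D is a periodic point of f and every nondegenerate arc in D contains a point which has dense orbit under f and is not an endpoint of D. -/
open Set Topology Filter TopologicalSpace

/-- A dendrite: a nondegenerate continuum in which any two distinct points can be
separated by a third point. -/
def IsDendrite (X : Type*) [TopologicalSpace X] : Prop :=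
  Nontrivial X ∧ ∀ x y : X, x ≠ y → ∃ z : X, z ≠ x ∧ z ≠ y ∧
    connectedComponentIn ({z}ᶜ : Set X) x ≠ connectedComponentIn ({z}ᶜ : Set X) y

/-- `p` is an endpoint of `X` if `X \ {p}` is connected. -/
def IsEndpointOf (X : Type*) [TopologicalSpace X] (p : X) : Prop :=
  IsPreconnected ({p}ᶜ : Set X)

/-- A periodic point of `f`. -/
def IsPeriodic {X : Type*} (f : X → X) (x : X) : Prop :=
  ∃ n : ℕ, 1 ≤ n ∧ f^[n] x = x

/-- `x` has dense forward orbit under `f`. -/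
def HasDenseOrbit {X : Type*} [TopologicalSpace X] (f : X → X) (x : X) : Prop :=
  Dense {y : X | ∃ n : ℕ, 1 ≤ n ∧ f^[n] x = y}

/-- Topological transitivity. -/
def TopTransitive {X : Type*} [TopologicalSpace X] (f : X → X) : Prop :=
  ∀ U V : Set X, IsOpen U → IsOpen V → U.Nonempty → V.Nonempty →
    ∃ n : ℕ, 0 < n ∧ (f^[n] '' U ∩ V).Nonempty

/-- Total transitivity: every iterate is transitive. -/
def TotallyTransitive {X : Type*} [TopologicalSpace X] (f : X → X) : Prop :=
  ∀ n : ℕ, 1 ≤ n → TopTransitive (f^[n])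

/-- Weak mixing: `f × f` is transitive. -/
def WeaklyMixing {X : Type*} [TopologicalSpace X] (f : X → X) : Prop :=
  TopTransitive (Prod.map f f)

/-- Topological mixing. -/
def TopMixing {X : Type*} [TopologicalSpace X] (f : X → X) : Prop :=
  ∀ U V : Set X, IsOpen U → IsOpen V → U.Nonempty → V.Nonempty →
    ∃ N : ℕ, ∀ n, N ≤ n → (f^[n] '' U ∩ V).Nonempty

/-- Exactness. -/
def TopExact {X : Type*} [TopologicalSpace X] (f : X → X) : Prop :=
  ∀ U : Set X, IsOpen U → U.Nonempty → ∃ N : ℕ, 0 < N ∧ f^[N] '' U = Set.univ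

/-- `A` is an arc with endpoints `a` and `b`. -/
def IsArcEnds {X : Type*} [TopologicalSpace X] (A : Set X) (a b : X) : Prop :=
  ∃ e : (Set.Icc (0:ℝ) 1) ≃ₜ A,
    (e ⟨0, by norm_num⟩ : X) = a ∧ (e ⟨1, by norm_num⟩ : X) = b

/-- `A` is a free arc with endpoints `a` and `b`. -/
def IsFreeArc {X : Type*} [TopologicalSpace X] (A : Set X) (a b : X) : Prop :=
  IsArcEnds A a b ∧ IsOpen (A \ {a, b})

/-- A regular periodic decomposition of length `m` for `f`. -/
def IsRegPerDecomp {X : Type*} [TopologicalSpace X] (f : X → X) (m : ℕ)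
    (Ds : ZMod m → Set X) : Prop :=
  0 < m ∧ (∀ i, Ds i = closure (interior (Ds i))) ∧ (⋃ i, Ds i) = Set.univ ∧
    (∀ i, f '' Ds i = Ds (i + 1)) ∧ (∀ i j, i ≠ j → IsNowhereDense (Ds i ∩ Ds j))

/-- `f` admits a terminal (maximal-length) regular periodic decomposition. -/
def HasTerminalDecomp {X : Type*} [TopologicalSpace X] (f : X → X) : Prop :=
  ∃ (m : ℕ) (Ds : ZMod m → Set X), IsRegPerDecomp f m Ds ∧
    ∀ (m' : ℕ) (Ds' : ZMod m' → Set X), IsRegPerDecomp f m' Ds' → m' ≤ m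

/-- The induced map on the hyperspace of nonempty closed (= compact) subsets. -/
def hyperMap {X : Type*} [TopologicalSpace X] {f : X → X} (hf : Continuous f) :
    NonemptyCompacts X → NonemptyCompacts X :=
  fun A => ⟨⟨f '' A, A.isCompact.image hf⟩, A.nonempty.image f⟩

/-- The set of connected components of `X \ {p}`. -/
def componentsAt (X : Type*) [TopologicalSpace X] (p : X) : Set (Set X) :=
  {C | ∃ x : X, x ≠ p ∧ C = connectedComponentIn ({p}ᶜ : Set X) x}

set_option linter.unusedSectionVars false

namespace FineDendrite

/-- The properties of a dendrite used below: distinct points are separated by a third one, every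
point has finite order, and endpoints are dense. -/
class IsFine (D : Type*) [TopologicalSpace D] : Prop where
  sep : ∀ x y : D, x ≠ y → ∃ z : D, z ≠ x ∧ z ≠ y ∧
    connectedComponentIn ({z}ᶜ : Set D) x ≠ connectedComponentIn ({z}ᶜ : Set D) y
  fin : ∀ p : D, (componentsAt D p).Finite
  dense : Dense {p : D | IsEndpointOf D p}

section Segments

variable {D : Type*} [TopologicalSpace D]

/-- The convex hull of two points: the points lying in every connected set containing both. -/
def seg (x y : D) : Set D :=
  {z | ∀ C : Set D, IsPreconnected C → x ∈ C → y ∈ C → z ∈ C}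

lemma left_mem_seg (x y : D) : x ∈ seg x y := fun _ _ hx _ => hx

lemma right_mem_seg (x y : D) : y ∈ seg x y := fun _ _ _ hy => hy

lemma seg_comm (x y : D) : seg x y = seg y x := by
  ext z; exact ⟨fun h C hC hx hy => h C hC hy hx, fun h C hC hx hy => h C hC hy hx⟩

lemma mem_seg_comm {x y z : D} (h : z ∈ seg x y) : z ∈ seg y x := seg_comm x y ▸ h

lemma seg_subset {x y : D} {C : Set D} (hC : IsPreconnected C) (hx : x ∈ C) (hy : y ∈ C) :
    seg x y ⊆ C := fun _ hz => hz C hC hx hy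

lemma eq_of_mem_seg_self {x z : D} (h : z ∈ seg x x) : z = x :=
  h {x} isPreconnected_singleton rfl rfl

lemma seg_subset_union (x y z : D) : seg x z ⊆ seg x y ∪ seg y z := by
  intro w hw
  by_contra h
  simp only [mem_union, not_or, seg, mem_ofPred_eq, not_forall] at h
  obtain ⟨⟨C, hC, hx, hy, hwC⟩, ⟨C', hC', hy', hz, hwC'⟩⟩ := h
  rcases hw (C ∪ C') (hC.union y hy hy' hC') (Or.inl hx) (Or.inr hz) with h | h
  exacts [hwC h, hwC' h]

lemma seg_subset_seg {x y p q : D} (hp : p ∈ seg x y) (hq : q ∈ seg x y) :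
    seg p q ⊆ seg x y :=
  fun _ hz C hC hx hy => hz C hC (hp C hC hx hy) (hq C hC hx hy)

lemma mem_connectedComponentIn_iff {x y z : D} (hx : x ≠ z) :
    y ∈ connectedComponentIn ({z}ᶜ : Set D) x ↔ z ∉ seg x y := by
  constructor
  · intro h hz
    exact connectedComponentIn_subset _ _ (hz _ isPreconnected_connectedComponentIn
      (mem_connectedComponentIn hx) h) rfl
  · intro h
    simp only [seg, mem_ofPred_eq, not_forall] at h
    obtain ⟨C, hC, hxC, hyC, hz⟩ := h
    exact hC.subset_connectedComponentIn hxC (by rintro w hw rfl; exact hz hw) hyC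

lemma not_mem_seg_of_isEndpoint {e x y : D} (he : IsEndpointOf D e) (hx : x ≠ e) (hy : y ≠ e) :
    e ∉ seg x y := fun h => h _ he hx hy rfl

/-- A convex set contains the hull of any two of its points. -/
def Convex (K : Set D) : Prop := ∀ x ∈ K, ∀ y ∈ K, seg x y ⊆ K

/-- The points not separated from `x` by a point of `F`. -/
def piece (F : Set D) (x : D) : Set D := {y | ∀ z ∈ F, z ∉ seg x y}

lemma mem_piece_self {F : Set D} {x : D} (hx : x ∉ F) : x ∈ piece F x :=
  fun _ hz h => hx (eq_of_mem_seg_self h ▸ hz)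

lemma mem_piece_symm {F : Set D} {x y : D} (h : y ∈ piece F x) : x ∈ piece F y :=
  fun z hz hzs => h z hz (mem_seg_comm hzs)

lemma mem_piece_trans {F : Set D} {x y z : D} (h : y ∈ piece F x) (h' : z ∈ piece F y) :
    z ∈ piece F x := fun w hw hws =>
  (seg_subset_union x y z hws).elim (h w hw) (h' w hw)

lemma piece_eq {F : Set D} {x y : D} (h : y ∈ piece F x) : piece F y = piece F x :=
  Subset.antisymm (fun _ hz => mem_piece_trans h hz)
    (fun _ hz => mem_piece_trans (mem_piece_symm h) hz)

lemma not_mem_of_mem_piece {F : Set D} {x y : D} (h : y ∈ piece F x) : y ∉ F :=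
  fun hy => h y hy (right_mem_seg x y)

lemma piece_anti {F G : Set D} (h : F ⊆ G) (x : D) : piece G x ⊆ piece F x :=
  fun _ hy z hz => hy z (h hz)

lemma piece_inter_convex (F : Set D) (x : D) : Convex (piece F x) := by
  intro y hy z hz w hw v hv hvs
  have h1 : v ∈ seg x z ∪ seg x y := by
    rcases seg_subset_union x y w hvs with h | h
    · exact Or.inr h
    · have h2 : v ∈ seg y z := seg_subset_seg (left_mem_seg y z) hw h
      exact (seg_subset_union y x z h2).elim (fun h => Or.inr (mem_seg_comm h)) Or.inl
  exact h1.elim (hz v hv) (hy v hv)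

end Segments

section Topology

variable {D : Type*} [TopologicalSpace D] [T1Space D] [PreconnectedSpace D] [IsFine D]

lemma exists_between {x y : D} (h : x ≠ y) : ∃ z ∈ seg x y, z ≠ x ∧ z ≠ y := by
  obtain ⟨z, hzx, hzy, hne⟩ := IsFine.sep x y h
  refine ⟨z, ?_, hzx, hzy⟩
  by_contra hz
  exact hne (connectedComponentIn_eq ((mem_connectedComponentIn_iff hzx.symm).2 hz))

lemma isOpen_component (z x : D) : IsOpen (connectedComponentIn ({z}ᶜ : Set D) x) := by
  by_cases hx : x = z
  · subst hx; rw [connectedComponentIn_eq_empty (by simp)]; exact isOpen_empty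
  set C := connectedComponentIn ({z}ᶜ : Set D) x with hC
  have hcl : ∀ u : D, u ≠ z → closure (connectedComponentIn ({z}ᶜ : Set D) u) ∩ {z}ᶜ ⊆
      connectedComponentIn ({z}ᶜ : Set D) u := fun u hu =>
    (isPreconnected_connectedComponentIn.subset_closure
      (subset_inter subset_closure (connectedComponentIn_subset _ _))
      inter_subset_left).subset_connectedComponentIn
      ⟨subset_closure (mem_connectedComponentIn hu), hu⟩ inter_subset_right
  have hfin : (componentsAt D z \ {C}).Finite := (IsFine.fin z).subset sdiff_subset
  have hE : C = {z}ᶜ ∩ (⋃ C' ∈ componentsAt D z \ {C}, closure C')ᶜ := by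
    ext w
    constructor
    · intro hw
      have hwz : w ≠ z := connectedComponentIn_subset _ _ hw
      refine ⟨hwz, ?_⟩
      simp only [mem_compl_iff, mem_iUnion, not_exists]
      rintro C' ⟨⟨u, hu, rfl⟩, hne⟩ hw'
      have := hcl u hu ⟨hw', hwz⟩
      exact hne (by rw [mem_singleton_iff, connectedComponentIn_eq this, hC,
        connectedComponentIn_eq hw])
    · rintro ⟨hwz, hw⟩
      by_contra hwC
      refine hw (mem_biUnion (x := connectedComponentIn ({z}ᶜ : Set D) w)
        ⟨⟨w, hwz, rfl⟩, fun h => hwC ?_⟩ (subset_closure (mem_connectedComponentIn hwz)))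
      rw [← mem_singleton_iff.1 h]; exact mem_connectedComponentIn hwz
  rw [hE]
  exact isOpen_compl_singleton.inter (hfin.isClosed_biUnion fun _ _ => isClosed_closure).isOpen_compl

lemma closure_component {z x : D} (hx : x ≠ z) :
    closure (connectedComponentIn ({z}ᶜ : Set D) x) =
      insert z (connectedComponentIn ({z}ᶜ : Set D) x) := by
  set C := connectedComponentIn ({z}ᶜ : Set D) x with hC
  have hxC : x ∈ C := mem_connectedComponentIn hx
  have hzC : z ∉ C := fun h => connectedComponentIn_subset _ _ h rfl
  have hsub : closure C ⊆ insert z C := by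
    intro w hw
    by_cases hwz : w = z
    · exact Or.inl hwz
    · exact Or.inr ((isPreconnected_connectedComponentIn.subset_closure
        (subset_inter subset_closure (connectedComponentIn_subset _ _))
        inter_subset_left).subset_connectedComponentIn
        ⟨subset_closure hxC, hx⟩ inter_subset_right ⟨hw, hwz⟩)
  refine hsub.antisymm (insert_subset ?_ subset_closure)
  by_contra hz
  have : IsClopen C := ⟨isClosed_of_closure_subset fun w hw =>
    (hsub hw).elim (fun h => absurd (h ▸ hw) hz) id, isOpen_component z x⟩
  rcases isClopen_iff.1 this with h | h
  · exact (h ▸ hxC : x ∈ (∅ : Set D))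
  · exact hzC (h ▸ mem_univ z)

lemma isPreconnected_insert_component {z x : D} (hx : x ≠ z) :
    IsPreconnected (insert z (connectedComponentIn ({z}ᶜ : Set D) x)) := by
  rw [← closure_component hx]; exact isPreconnected_connectedComponentIn.closure

lemma eq_of_mem_seg_seg {x y z w : D} (hz : z ∈ seg x y) (h1 : w ∈ seg x z) (h2 : w ∈ seg z y) :
    w = z := by
  by_contra hw
  by_cases hxz : x = z
  · subst hxz; exact hw (eq_of_mem_seg_self h1)
  by_cases hyz : y = z
  · subst hyz; exact hw (eq_of_mem_seg_self h2)
  have key : ∀ u : D, u ≠ z → w ∈ seg u z → z ∉ seg u w := fun u hu h =>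
    (mem_connectedComponentIn_iff hu).1 ((h _ (isPreconnected_insert_component hu)
      (Or.inr (mem_connectedComponentIn hu)) (Or.inl rfl)).resolve_left hw)
  exact (seg_subset_union x w y hz).elim (key x hxz h1)
    fun h => key y hyz (mem_seg_comm h2) (mem_seg_comm h)

lemma seg_antisymm {x z w : D} (h1 : w ∈ seg x z) (h2 : z ∈ seg x w) : w = z :=
  eq_of_mem_seg_seg h2 h1 (right_mem_seg z w)

lemma isClosed_seg (x y : D) : IsClosed (seg x y) := by
  refine isClosed_of_closure_subset fun z hz => ?_
  by_contra hzs
  have hxz : x ≠ z := fun h => hzs (h ▸ left_mem_seg x y)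
  have hy := (mem_connectedComponentIn_iff hxz).2 hzs
  have hK : ∃ K : Set D, IsClosed K ∧ IsPreconnected K ∧ x ∈ K ∧ y ∈ K ∧ z ∉ K := by
    refine (isPreconnected_connectedComponentIn (x := x) (F := ({z}ᶜ : Set D))).induction₂
      (fun u v => ∃ K : Set D, IsClosed K ∧ IsPreconnected K ∧ u ∈ K ∧ v ∈ K ∧ z ∉ K)
      ?_ ?_ ?_ (mem_connectedComponentIn hxz) hy
    · intro c hc
      have hcz : c ≠ z := connectedComponentIn_subset _ _ hc
      obtain ⟨w, hw, hwc, hwz⟩ := exists_between hcz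
      refine mem_nhdsWithin_of_mem_nhds (Filter.mem_of_superset
        ((isOpen_component w c).mem_nhds (mem_connectedComponentIn hwc.symm)) fun v hv => ?_)
      refine ⟨closure (connectedComponentIn ({w}ᶜ : Set D) c), isClosed_closure,
        isPreconnected_connectedComponentIn.closure,
        subset_closure (mem_connectedComponentIn hwc.symm), subset_closure hv, ?_⟩
      rw [closure_component hwc.symm]
      rintro (h | h)
      · exact hwz h.symm
      · exact (mem_connectedComponentIn_iff hwc.symm).1 h hw
    · rintro u v w _ _ _ ⟨K, h1, h2, h3, h4, h5⟩ ⟨K', h1', h2', h3', h4', h5'⟩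
      exact ⟨K ∪ K', h1.union h1', h2.union v h4 h3' h2', Or.inl h3, Or.inr h4',
        fun h => h.elim h5 h5'⟩
    · rintro u v _ _ ⟨K, h1, h2, h3, h4, h5⟩
      exact ⟨K, h1, h2, h4, h3, h5⟩
  obtain ⟨K, h1, h2, h3, h4, h5⟩ := hK
  exact h5 (closure_minimal (seg_subset h2 h3 h4) h1 hz)

lemma isOpen_piece {F : Set D} (hF : F.Finite) (x : D) : IsOpen (piece F x) := by
  by_cases hx : x ∈ F
  · convert isOpen_empty
    exact eq_empty_of_forall_notMem fun y hy => hy x hx (left_mem_seg x y)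
  have : piece F x = ⋂ z ∈ F, connectedComponentIn ({z}ᶜ : Set D) x := by
    ext y
    simp only [piece, mem_ofPred_eq, mem_iInter]
    exact forall₂_congr fun z hz =>
      (mem_connectedComponentIn_iff (by rintro rfl; exact hx hz)).symm
  rw [this]
  exact hF.isOpen_biInter fun z _ => isOpen_component z x

variable [CompactSpace D]

lemma isPreconnected_seg (x y : D) : IsPreconnected (seg x y) := by
  rw [isPreconnected_closed_iff]
  intro t t' ht ht' hsub hne hne'
  by_contra hemp
  set M := seg x y ∩ t with hM
  set N := seg x y ∩ t' with hN
  have hMN : ∀ w, w ∈ M → w ∈ N → False := fun w h h' => hemp ⟨w, h.1, h.2, h'.2⟩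
  have hMc : IsClosed M := (isClosed_seg x y).inter ht
  have hNc : IsClosed N := (isClosed_seg x y).inter ht'
  obtain ⟨s, hs⟩ := zorn_superset {s : Set D | ∃ m ∈ M, ∃ n ∈ N, s = seg m n} (by
    intro c hc hchain
    rcases c.eq_empty_or_nonempty with rfl | hcne
    · obtain ⟨m, hm⟩ := hne
      obtain ⟨n, hn⟩ := hne'
      exact ⟨_, ⟨m, hm, n, hn, rfl⟩, by simp⟩
    have : Nonempty c := hcne.to_subtype
    have hdir : Directed (· ⊇ ·) fun s : c => (M ∩ s.1) ×ˢ (N ∩ s.1) := by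
      intro a b
      rcases hchain.total a.2 b.2 with h | h
      · exact ⟨a, Subset.rfl, prod_mono (inter_subset_inter_right _ h)
          (inter_subset_inter_right _ h)⟩
      · exact ⟨b, prod_mono (inter_subset_inter_right _ h)
          (inter_subset_inter_right _ h), Subset.rfl⟩
    have hcl : ∀ s : c, IsClosed ((M ∩ s.1) ×ˢ (N ∩ s.1)) := by
      rintro ⟨s, hs⟩
      obtain ⟨m, hm, n, hn, rfl⟩ := hc hs
      exact (hMc.inter (isClosed_seg m n)).prod (hNc.inter (isClosed_seg m n))
    obtain ⟨⟨m, n⟩, hmn⟩ := IsCompact.nonempty_iInter_of_directed_nonempty_isCompact_isClosed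
      _ hdir (by
        rintro ⟨s, hs⟩
        obtain ⟨m, hm, n, hn, rfl⟩ := hc hs
        exact ⟨(m, n), ⟨hm, left_mem_seg m n⟩, ⟨hn, right_mem_seg m n⟩⟩)
      (fun s => (hcl s).isCompact) hcl
    simp only [mem_iInter, mem_prod, mem_inter_iff] at hmn
    obtain ⟨s0, hs0⟩ := hcne
    refine ⟨seg m n, ⟨m, (hmn ⟨s0, hs0⟩).1.1, n, (hmn ⟨s0, hs0⟩).2.1, rfl⟩, fun s hs => ?_⟩
    obtain ⟨m', hm', n', hn', rfl⟩ := hc hs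
    exact seg_subset_seg (hmn ⟨_, hs⟩).1.2 (hmn ⟨_, hs⟩).2.2)
  obtain ⟨⟨m, hm, n, hn, rfl⟩, hmin⟩ := hs
  have hmn : m ≠ n := fun h => hMN m hm (h ▸ hn)
  obtain ⟨w, hw, hwm, hwn⟩ := exists_between hmn
  have hwxy : w ∈ seg x y := seg_subset_seg hm.1 hn.1 hw
  rcases hsub hwxy with h | h
  · have := hmin ⟨w, ⟨hwxy, h⟩, n, hn, rfl⟩ (seg_subset_seg hw (right_mem_seg m n))
      (left_mem_seg m n)
    exact hwm (seg_antisymm (mem_seg_comm this) (mem_seg_comm hw)).symm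
  · have := hmin ⟨m, hm, w, ⟨hwxy, h⟩, rfl⟩ (seg_subset_seg (left_mem_seg m n) hw)
      (right_mem_seg m n)
    exact hwn (seg_antisymm this hw).symm

lemma exists_median (x y z : D) : ∃ m, m ∈ seg x y ∧ m ∈ seg x z ∧ m ∈ seg y z := by
  obtain ⟨m, h1, h2, h3⟩ := isPreconnected_closed_iff.1 (isPreconnected_seg x y) _ _
    (isClosed_seg x z) (isClosed_seg z y) (seg_subset_union x z y)
    ⟨x, left_mem_seg x y, left_mem_seg x z⟩ ⟨y, right_mem_seg x y, right_mem_seg z y⟩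
  exact ⟨m, h1, h2, mem_seg_comm h3⟩

end Topology

section BranchPoints

variable {D : Type*} [MetricSpace D] [CompactSpace D] [ConnectedSpace D] [IsFine D]

variable (D) in
/-- The set of branch points. -/
def branchPoints : Set D := {p | 3 ≤ (componentsAt D p).ncard}

lemma mem_branchPoints {x y z b : D} (hxy : b ∈ seg x y) (hxz : b ∈ seg x z) (hyz : b ∈ seg y z)
    (hx : x ≠ b) (hy : y ≠ b) (hz : z ≠ b) : b ∈ branchPoints D := by
  have key : ∀ u v : D, u ≠ b → v ≠ b → b ∈ seg u v →
      connectedComponentIn ({b}ᶜ : Set D) u ≠ connectedComponentIn ({b}ᶜ : Set D) v :=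
    fun u v hu hv h he => (mem_connectedComponentIn_iff hu).1
      (he ▸ mem_connectedComponentIn hv) h
  have h3 : ({connectedComponentIn ({b}ᶜ : Set D) x, connectedComponentIn ({b}ᶜ : Set D) y,
      connectedComponentIn ({b}ᶜ : Set D) z} : Set (Set D)).ncard = 3 :=
    ncard_eq_three.2 ⟨_, _, _, key x y hx hy hxy, key x z hx hz hxz, key y z hy hz hyz, rfl⟩
  rw [branchPoints, mem_ofPred_eq, ← h3]
  refine ncard_le_ncard ?_ (IsFine.fin b)
  rintro _ (rfl | rfl | rfl)
  exacts [⟨x, hx, rfl⟩, ⟨y, hy, rfl⟩, ⟨z, hz, rfl⟩]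

lemma exists_branchPoint_between {x y : D} (h : x ≠ y) :
    ∃ b ∈ branchPoints D, b ∈ seg x y ∧ b ≠ x ∧ b ≠ y := by
  obtain ⟨z, hz, hzx, hzy⟩ := exists_between h
  obtain ⟨z', hz', hzx', hzz'⟩ := exists_between hzx.symm
  obtain ⟨w, hw, hwz', hwz⟩ := exists_between hzz'
  have hzz'x : z ∉ seg z' x := fun h => hzz' (seg_antisymm hz' (mem_seg_comm h))
  have hzw : z ∉ seg z' w := fun h => hwz (seg_antisymm hw h)
  have hz'w : z' ∉ seg z w := fun h => hwz' (seg_antisymm (mem_seg_comm hw) h)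
  have hz'y : z' ∉ seg z y := fun h => hzz' (eq_of_mem_seg_seg hz hz' h)
  obtain ⟨e, he, hee⟩ := IsFine.dense.exists_mem_open
    ((isOpen_piece (finite_singleton z) z').inter (isOpen_piece (finite_singleton z') z))
    ⟨w, by simpa [piece] using hzw, by simpa [piece] using hz'w⟩
  replace hee : z ∉ seg z' e ∧ z' ∉ seg z e := by simpa [piece] using hee
  have hz'ey : z' ∉ seg e y := fun h => (seg_subset_union e z y h).elim
    (fun h => hee.2 (mem_seg_comm h)) hz'y
  have hzex : z ∉ seg e x := fun h => (seg_subset_union e z' x h).elim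
    (fun h => hee.1 (mem_seg_comm h)) hzz'x
  have hex : x ≠ e := fun h => hee.2 (h ▸ mem_seg_comm hz')
  have hey : y ≠ e := by
    rintro rfl
    exact (seg_subset_union x z' y hz).elim (fun h => hzz'x (mem_seg_comm h)) hee.1
  obtain ⟨m, h1, h2, h3⟩ := exists_median x y e
  have hme : m ≠ e := fun h => not_mem_seg_of_isEndpoint he hex hey (h ▸ h1)
  have hmx : m ≠ x := by
    rintro rfl
    exact hz'ey (seg_subset_seg (left_mem_seg e y) (mem_seg_comm h3)
      ((seg_subset_union m e z hz').elim mem_seg_comm fun h => absurd (mem_seg_comm h) hee.2))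
  have hmy : m ≠ y := by
    rintro rfl
    have : z ∈ seg e m := (seg_subset_union x e m hz).elim
      (fun h => absurd (mem_seg_comm h) hzex) id
    exact hzex (seg_subset_seg (left_mem_seg e x) (mem_seg_comm h2) this)
  exact ⟨m, mem_branchPoints h1 h2 h3 hmx.symm hmy.symm hme.symm, h1, hmx, hmy⟩

lemma countable_branchPoints : (branchPoints D).Countable := by
  have hseg : ∀ x y : D, {b | b ∈ branchPoints D ∧ b ∈ seg x y ∧ b ≠ x ∧ b ≠ y}.Countable := by
    intro x y
    have hC : ∀ b : D, b ∈ branchPoints D → ∃ u, u ≠ b ∧ b ∈ seg u x ∧ b ∈ seg u y ∨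
        b = x ∨ b = y := by
      intro b hb
      by_cases hbx : b = x
      · exact ⟨x, Or.inr (Or.inl hbx)⟩
      by_cases hby : b = y
      · exact ⟨x, Or.inr (Or.inr hby)⟩
      by_contra hcon
      have hsub : componentsAt D b ⊆ {connectedComponentIn ({b}ᶜ : Set D) x,
          connectedComponentIn ({b}ᶜ : Set D) y} := by
        rintro _ ⟨u, hu, rfl⟩
        by_contra hu'
        simp only [mem_insert_iff, mem_singleton_iff, not_or] at hu'
        refine hcon ⟨u, Or.inl ⟨hu, ?_, ?_⟩⟩
        · by_contra h
          exact hu'.1 (connectedComponentIn_eq ((mem_connectedComponentIn_iff hu).2 h))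
        · by_contra h
          exact hu'.2 (connectedComponentIn_eq ((mem_connectedComponentIn_iff hu).2 h))
      have h2 := (ncard_le_ncard hsub (toFinite _)).trans (ncard_insert_le _ _)
      rw [ncard_singleton] at h2
      have h3 : 3 ≤ (componentsAt D b).ncard := hb
      omega
    choose! u hu using hC
    refine PairwiseDisjoint.countable_of_isOpen (s := fun b => piece {b} (u b)) ?_
      (fun b _ => isOpen_piece (finite_singleton b) _) ?_
    · rintro b ⟨hb, hbs, hbx, hby⟩ b' ⟨hb', hbs', hbx', hby'⟩ hne
      refine disjoint_left.2 fun v hv hv' => hne ?_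
      replace hv : b ∉ seg (u b) v := by simpa [piece] using hv
      replace hv' : b' ∉ seg (u b') v := by simpa [piece] using hv'
      obtain ⟨-, h1, h2⟩ := (hu b hb).resolve_right (by tauto)
      obtain ⟨-, h1', h2'⟩ := (hu b' hb').resolve_right (by tauto)
      replace h1 : b ∈ seg v x := (seg_subset_union _ v x h1).resolve_left hv
      replace h2 : b ∈ seg v y := (seg_subset_union _ v y h2).resolve_left hv
      replace h1' : b' ∈ seg v x := (seg_subset_union _ v x h1').resolve_left hv'
      replace h2' : b' ∈ seg v y := (seg_subset_union _ v y h2').resolve_left hv'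
      have key : ∀ x y : D, b ∈ seg v x → b' ∈ seg v y → b ∈ seg x y → b' ∈ seg x b →
          b = b' := by
        intro x y h1 h2' hbs h
        rcases seg_subset_union v b' x h1 with h3 | h3
        · rcases seg_subset_union v b y h2' with h4 | h4
          · exact seg_antisymm h3 h4
          · exact (eq_of_mem_seg_seg hbs h h4).symm
        · exact seg_antisymm (mem_seg_comm h3) h
      rcases seg_subset_union x b y hbs' with h | h
      · exact key x y h1 h2' hbs h
      · exact key y x h2 h1' (mem_seg_comm hbs) (mem_seg_comm h)
    · rintro b ⟨hb, hbs, hbx, hby⟩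
      obtain ⟨h0, -, -⟩ := (hu b hb).resolve_right (by tauto)
      exact ⟨u b, mem_piece_self (by simpa using h0)⟩
  obtain ⟨S, hS, hSd⟩ := exists_countable_dense D
  refine ((hS.prod hS).biUnion (t := fun (p : D × D) _ =>
    {b | b ∈ branchPoints D ∧ b ∈ seg p.1 p.2 ∧ b ≠ p.1 ∧ b ≠ p.2})
    fun p _ => hseg p.1 p.2).mono ?_
  intro b hb
  have h2 : 1 < (componentsAt D b).ncard := by
    have : 3 ≤ (componentsAt D b).ncard := hb
    omega
  obtain ⟨_, ⟨u, hu, rfl⟩, _, ⟨v, hv, rfl⟩, huv⟩ := (one_lt_ncard (IsFine.fin b)).1 h2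
  obtain ⟨s, hs, hsu⟩ := hSd.exists_mem_open (isOpen_component b u)
    ⟨u, mem_connectedComponentIn hu⟩
  obtain ⟨t, ht, htv⟩ := hSd.exists_mem_open (isOpen_component b v)
    ⟨v, mem_connectedComponentIn hv⟩
  have hsb : s ≠ b := connectedComponentIn_subset _ _ hsu
  have htb : t ≠ b := connectedComponentIn_subset _ _ htv
  refine mem_iUnion₂.2 ⟨(s, t), ⟨hs, ht⟩, hb, ?_, hsb.symm, htb.symm⟩
  by_contra h
  refine huv ?_
  rw [connectedComponentIn_eq hsu, connectedComponentIn_eq htv]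
  exact connectedComponentIn_eq ((mem_connectedComponentIn_iff hsb).2 h)

/-- Points that are not branch points accumulate at the ends of every segment. -/
lemma exists_near {c p : D} (h : c ≠ p) {O : Set D} (hO : IsOpen O) (hc : c ∈ O) :
    ∃ y ∈ seg c p, y ∈ O ∧ y ≠ c ∧ y ≠ p ∧ y ∉ branchPoints D := by
  obtain ⟨r, hr, hball⟩ := Metric.isOpen_iff.1 hO c hc
  set d := min r (dist c p) with hd
  have hd0 : 0 < d := lt_min hr (dist_pos.2 h)
  have hsurj : Ioo 0 d ⊆ (fun y => dist c y) '' seg c p := by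
    have := (isPreconnected_seg c p).image (fun y => dist c y) (by fun_prop)
    refine Subset.trans ?_ (this.Icc_subset ⟨c, left_mem_seg c p, dist_self c⟩
      ⟨p, right_mem_seg c p, rfl⟩)
    exact fun t ht => ⟨ht.1.le, ht.2.le.trans (min_le_right _ _)⟩
  by_contra hcon
  push Not at hcon
  have : Ioo 0 d ⊆ (fun y => dist c y) '' branchPoints D := by
    intro t ht
    obtain ⟨y, hy, rfl⟩ := hsurj ht
    simp only [mem_Ioo] at ht
    refine ⟨y, hcon y hy (hball ?_) ?_ ?_, rfl⟩
    · rw [Metric.mem_ball, dist_comm]; exact ht.2.trans_le (min_le_left _ _)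
    · rintro rfl; simp at ht
    · rintro rfl; exact absurd (ht.2.trans_le (min_le_right _ _)) (lt_irrefl _)
  have hcount : (Ioo 0 d).Countable := (countable_branchPoints.image _).mono this
  have h2 := Cardinal.mk_Ioo_real hd0
  have h3 := hcount.le_aleph0
  rw [h2] at h3
  exact absurd h3 (not_le.2 Cardinal.aleph0_lt_continuum)

/-- Every neighbourhood of `x` contains a convex one cut out by finitely many points. -/
lemma exists_piece_subset {x : D} {O : Set D} (hO : IsOpen O) (hx : x ∈ O) :
    ∃ Z : Set D, Z.Finite ∧ x ∉ Z ∧ piece Z x ⊆ O := by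
  have hsep : ∀ y : D, y ∈ Oᶜ → ∃ z, z ∈ seg x y ∧ z ≠ x ∧ z ≠ y := fun y hy =>
    exists_between (fun h => hy (h ▸ hx))
  choose! z hz hzx hzy using hsep
  obtain ⟨t, hcov⟩ := hO.isClosed_compl.isCompact.elim_nhds_subcover'
    (fun y _ => piece {z y} y) (fun y hy => (isOpen_piece (finite_singleton _) _).mem_nhds
      (mem_piece_self (fun h => hzy y hy (mem_singleton_iff.1 h).symm)))
  refine ⟨z ∘ Subtype.val '' (t : Set (Oᶜ : Set D)), t.finite_toSet.image _, ?_, ?_⟩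
  · rintro ⟨y, hy, h⟩; exact hzx y.1 y.2 h
  · intro y hy
    by_contra hyO
    obtain ⟨w, hw, hyw⟩ := mem_iUnion₂.1 (hcov hyO)
    have h1 : z w.1 ∉ seg w.1 y := hyw _ rfl
    exact hy (z w) ⟨w, hw, rfl⟩ ((seg_subset_union x y w.1 (hz w w.2)).resolve_right
      fun h => h1 (mem_seg_comm h))

lemma exists_branchPoint_seg {a b : D} (h : a ≠ b) {E : Set D} (hE : E.Finite) :
    ∃ c ∈ branchPoints D, c ∈ seg a b ∧ c ∉ E ∧ c ≠ a ∧ c ≠ b := by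
  obtain ⟨y, hy, hyO, hya, -, -⟩ := exists_near h
    (isOpen_piece (hE.subset (sdiff_subset (t := {a}))) a) (mem_piece_self (by simp))
  obtain ⟨c, hc, hcs, hca, hcy⟩ := exists_branchPoint_between hya.symm
  refine ⟨c, hc, seg_subset_seg (left_mem_seg a b) hy hcs, fun hcE => hyO c ⟨hcE, hca⟩ hcs,
    hca, ?_⟩
  rintro rfl
  exact hcy (seg_antisymm hcs hy)

variable [Nontrivial D]

lemma infinite_inter_branchPoints {O : Set D} (hO : IsOpen O) (hne : O.Nonempty) :
    (O ∩ branchPoints D).Infinite := by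
  intro hfin
  obtain ⟨x, hx⟩ := hne
  obtain ⟨x', hx'⟩ := exists_ne x
  obtain ⟨Z, hZ, hxZ, hsub⟩ := exists_piece_subset hO hx
  obtain ⟨y, -, hy, hyx, -⟩ := exists_near hx'.symm (isOpen_piece hZ x) (mem_piece_self hxZ)
  obtain ⟨c, hc, hcs, hcE, -⟩ := exists_branchPoint_seg hyx.symm hfin
  exact hcE ⟨hsub (piece_inter_convex Z x x (mem_piece_self hxZ) y hy hcs), hc⟩

lemma dense_branchPoints : Dense (branchPoints D) :=
  dense_iff_inter_open.2 fun _ hO hne => (infinite_inter_branchPoints hO hne).nonempty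

/-- Finitely many branch points separate all pairs of points at distance at least `ε`. -/
lemma exists_finite_separating {ε : ℝ} (hε : 0 < ε) : ∃ G : Set D, G.Finite ∧
    G ⊆ branchPoints D ∧
    ∀ x y : D, ε ≤ dist x y → ∃ v ∈ G, v ∈ seg x y ∧ v ≠ x ∧ v ≠ y := by
  have hcl : IsClosed {p : D × D | ε ≤ dist p.1 p.2} :=
    isClosed_le continuous_const (by fun_prop)
  have hsep : ∀ p : D × D, p ∈ {p : D × D | ε ≤ dist p.1 p.2} →
      ∃ z ∈ branchPoints D, z ∈ seg p.1 p.2 ∧ z ≠ p.1 ∧ z ≠ p.2 := fun p hp =>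
    exists_branchPoint_between (fun h => by
      have : ε ≤ dist p.1 p.2 := hp
      rw [h, dist_self] at this; linarith)
  choose! z hzB hz hz1 hz2 using hsep
  obtain ⟨t, hcov⟩ := hcl.isCompact.elim_nhds_subcover'
    (fun p _ => piece {z p} p.1 ×ˢ piece {z p} p.2) (fun p hp =>
      ((isOpen_piece (finite_singleton _) _).prod (isOpen_piece (finite_singleton _) _)).mem_nhds
      ⟨mem_piece_self (fun h => hz1 p hp (mem_singleton_iff.1 h).symm),
        mem_piece_self (fun h => hz2 p hp (mem_singleton_iff.1 h).symm)⟩)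
  refine ⟨(fun p => z p.1) '' (t : Set {p : D × D | ε ≤ dist p.1 p.2}), t.finite_toSet.image _,
    ?_, ?_⟩
  · rintro _ ⟨p, -, rfl⟩; exact hzB p.1 p.2
  · intro x y hxy
    obtain ⟨p, hp, h⟩ := mem_iUnion₂.1 (hcov (a := (x, y)) hxy)
    have h1 : z p ∉ seg p.1.1 x := h.1 _ rfl
    have h2 : z p ∉ seg p.1.2 y := h.2 _ rfl
    refine ⟨z p, ⟨p, hp, rfl⟩, ?_, ?_, ?_⟩
    · have h3 := hz p p.2
      rcases seg_subset_union _ x _ h3 with h4 | h4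
      · exact absurd h4 h1
      · exact (seg_subset_union _ y _ h4).resolve_right fun h => h2 (mem_seg_comm h)
    · intro he; exact h1 (he ▸ right_mem_seg _ _)
    · intro he; exact h2 (he ▸ right_mem_seg _ _)

end BranchPoints


section States

variable {D : Type*} [MetricSpace D]

/-- There is a path of length `m` from `x` to `y` along the relation `z ∈ K x` avoiding `F` after
the first step. -/
def Reach (F : Set D) (K : D → Set D) : ℕ → D → D → Prop
  | 0, x, y => x = y
  | m + 1, x, y => ∃ z ∈ K x, z ∉ F ∧ Reach F K m z y

lemma Reach.exists_path {F : Set D} {K : D → Set D} {m : ℕ} {x y : D} (h : Reach F K m x y) :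
    ∃ s : ℕ → D, s 0 = x ∧ s m = y ∧ ∀ i < m, s (i + 1) ∈ K (s i) ∧ s (i + 1) ∉ F := by
  induction m generalizing x with
  | zero => exact ⟨fun _ => x, rfl, h, by simp⟩
  | succ m ih =>
    obtain ⟨z, hz, hzF, hr⟩ := h
    obtain ⟨s, h0, hm, hs⟩ := ih hr
    refine ⟨fun i => Nat.casesOn i x s, rfl, hm, fun i hi => ?_⟩
    cases i with
    | zero => exact ⟨(h0 ▸ hz : s 0 ∈ K x), (h0 ▸ hzF : s 0 ∉ F)⟩
    | succ i => exact hs i (by omega)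

/-- Paths for `(F, K)` lift to paths for a refinement `(F', K')`. -/
lemma Reach.refine {F F' : Set D} {K K' : D → Set D}
    (hsat : ∀ x y, x ∉ F → y ∈ K x → y ∉ F → piece F y ⊆ K x)
    (hpre : ∀ x z, x ∉ F → z ∈ K x → ∃ x' ∈ piece F x, x' ∉ F' ∧ z ∈ K' x')
    {m : ℕ} {x y : D} (h : Reach F K m x y) (hx : x ∉ F) (hy : y ∉ F') :
    ∃ x' ∈ piece F x, x' ∉ F' ∧ Reach F' K' m x' y := by
  induction m generalizing x with
  | zero =>
    obtain rfl : x = y := h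
    exact ⟨x, mem_piece_self hx, hy, rfl⟩
  | succ m ih =>
    obtain ⟨z, hz, hzF, hr⟩ := h
    obtain ⟨z', hz', hzF', hr'⟩ := ih hr hzF
    obtain ⟨x', hx', hxF', hzx⟩ := hpre x z' hx (hsat x z hx hz hzF hz')
    exact ⟨x', hx', hxF', z', hzx, hzF', hr'⟩

variable (D) in
/-- A finite approximation of a continuous map: the values `f` on a finite invariant set `F`, and
for each component `P` of the complement of `F` a closed convex set `K` containing the image of
`P`. -/
structure State where
  /-- The points at which the map is already determined. -/
  F : Set D
  /-- The map, relevant only on `F`. -/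
  f : D → D
  /-- The constraint on the value at a point. -/
  K : D → Set D
  finite : F.Finite
  nonempty : F.Nonempty
  map : ∀ x ∈ F, f x ∈ F
  K_of_mem : ∀ x ∈ F, K x = {f x}
  periodic : ∀ x ∈ F, x ∈ branchPoints D → IsPeriodic f x
  closed : ∀ x, IsClosed (K x)
  convex : ∀ x, Convex (K x)
  sat : ∀ x y, x ∉ F → y ∈ K x → y ∉ F → piece F y ⊆ K x
  const : ∀ x y, x ∉ F → y ∈ piece F x → K y = K x
  adj : ∀ c x, c ∈ F → x ∉ F → seg c x ∩ F ⊆ {c} → f c ∈ K x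
  mixing : ∃ N, ∀ m ≥ N, ∀ x y, x ∉ F → y ∉ F → Reach F K m x y

instance : Preorder (State D) where
  le S T := S.F ⊆ T.F ∧ ∀ x, T.K x ⊆ S.K x
  le_refl S := ⟨Subset.rfl, fun _ => Subset.rfl⟩
  le_trans S T R h h' := ⟨h.1.trans h'.1, fun x => (h'.2 x).trans (h.2 x)⟩

namespace State

lemma f_eq_of_le {S T : State D} (h : S ≤ T) {x : D} (hx : x ∈ S.F) : T.f x = S.f x := by
  have := h.2 x
  rw [S.K_of_mem x hx, T.K_of_mem x (h.1 hx)] at this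
  simpa using this

lemma iterate_mem (S : State D) {x : D} (hx : x ∈ S.F) (n : ℕ) : S.f^[n] x ∈ S.F :=
  (MapsTo.iterate (s := S.F) (fun x hx => S.map x hx) n) hx

lemma iterate_eq {S : State D} {f : D → D} (h : ∀ x ∈ S.F, f x = S.f x) {x : D} (hx : x ∈ S.F)
    (n : ℕ) : f^[n] x = S.f^[n] x := by
  induction n with
  | zero => rfl
  | succ n ih => rw [Function.iterate_succ_apply', Function.iterate_succ_apply', ih,
      h _ (S.iterate_mem hx n)]

lemma exists_mem_K (S : State D) {x : D} (hx : x ∉ S.F) : ∃ z ∈ S.K x, z ∉ S.F := by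
  obtain ⟨N, hN⟩ := S.mixing
  obtain ⟨z, hz, hzF, -⟩ := hN (N + 1) (by omega) x x hx hx
  exact ⟨z, hz, hzF⟩

lemma mixing_refine (S : State D) {F' : Set D} {K' : D → Set D} (hFF : S.F ⊆ F')
    (hpre : ∀ x z, x ∉ S.F → z ∈ S.K x → ∃ x' ∈ piece S.F x, x' ∉ F' ∧ z ∈ K' x')
    (himg : ∀ x, x ∉ F' → ∃ a, a ∉ S.F ∧ piece S.F a ⊆ K' x) :
    ∃ N, ∀ m ≥ N, ∀ x y, x ∉ F' → y ∉ F' → Reach F' K' m x y := by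
  obtain ⟨N, hN⟩ := S.mixing
  refine ⟨N + 1, fun m hm x y hx hy => ?_⟩
  obtain ⟨m, rfl⟩ := Nat.exists_eq_add_of_le' (show 1 ≤ m by omega)
  obtain ⟨a, ha, haK⟩ := himg x hx
  obtain ⟨z, hz, hzF, hr⟩ := (hN m (by omega) a y ha fun h => hy (hFF h)).refine S.sat
    hpre ha hy
  exact ⟨z, haK hz, hzF, hr⟩

variable [CompactSpace D] [ConnectedSpace D] [IsFine D] [Nontrivial D]

open Classical in
/-- Add a periodic orbit of branch points to the determined points. -/
lemma exists_cycle (S : State D) {m : ℕ} [NeZero m] (cyc : ZMod m → D)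
    (hinj : Function.Injective cyc) (hF : ∀ i, cyc i ∉ S.F)
    (hK : ∀ i, cyc (i + 1) ∈ S.K (cyc i)) :
    ∃ T, S ≤ T ∧ T.F = S.F ∪ range cyc ∧ (∀ x, x ∉ T.F → T.K x = S.K x) ∧
      ∀ i k, T.f^[k] (cyc i) = cyc (i + k) := by
  set f' := Function.extend cyc (fun i => cyc (i + 1)) S.f with hf'
  have hfc : ∀ i, f' (cyc i) = cyc (i + 1) := fun i => hinj.extend_apply _ _ i
  have hfF : ∀ x ∈ S.F, f' x = S.f x := fun x hx =>
    Function.extend_apply' _ _ _ (by rintro ⟨i, rfl⟩; exact hF i hx)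
  have hit : ∀ i (k : ℕ), f'^[k] (cyc i) = cyc (i + k) := by
    intro i k
    induction k with
    | zero => simp
    | succ k ih => rw [Function.iterate_succ_apply', ih, hfc]; push_cast; rw [add_assoc]
  set F' := S.F ∪ range cyc with hF'
  set K' : D → Set D := fun x => if x ∈ F' then {f' x} else S.K x with hK'
  have hK'm : ∀ x ∈ F', K' x = {f' x} := fun x hx => if_pos hx
  have hK'n : ∀ x, x ∉ F' → K' x = S.K x := fun x hx => if_neg hx
  have hsub : S.F ⊆ F' := subset_union_left
  have hfin : F'.Finite := S.finite.union (finite_range cyc)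
  have hnS : ∀ {x}, x ∉ F' → x ∉ S.F := fun hx h => hx (hsub h)
  refine ⟨⟨F', f', K', hfin, S.nonempty.mono hsub, ?_, hK'm, ?_, ?_, ?_, ?_, ?_, ?_, ?_⟩,
    ⟨hsub, ?_⟩, rfl, hK'n, hit⟩
  · rintro _ (hx | ⟨i, rfl⟩)
    · rw [hfF _ hx]; exact Or.inl (S.map _ hx)
    · rw [hfc]; exact Or.inr ⟨_, rfl⟩
  · rintro _ (hx | ⟨i, rfl⟩) hB
    · obtain ⟨n, hn, h⟩ := S.periodic _ hx hB
      exact ⟨n, hn, by rw [iterate_eq hfF hx, h]⟩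
    · exact ⟨m, NeZero.one_le, by rw [hit]; simp⟩
  · intro x
    by_cases hx : x ∈ F'
    · rw [hK'm x hx]; exact isClosed_singleton
    · rw [hK'n x hx]; exact S.closed x
  · intro x
    by_cases hx : x ∈ F'
    · rw [hK'm x hx]
      rintro a rfl b rfl c hc
      exact eq_of_mem_seg_self hc
    · rw [hK'n x hx]; exact S.convex x
  · intro x y hx hy hyF
    rw [hK'n x hx] at hy ⊢
    exact (piece_anti hsub y).trans (S.sat x y (hnS hx) hy (hnS hyF))
  · intro x y hx hy
    rw [hK'n x hx, hK'n y (not_mem_of_mem_piece hy)]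
    exact S.const x y (hnS hx) (piece_anti hsub x hy)
  · rintro _ x (hc | ⟨i, rfl⟩) hx hs
    · rw [hfF _ hc, hK'n x hx]
      exact S.adj _ x hc (hnS hx) ((inter_subset_inter_right _ hsub).trans hs)
    · rw [hfc, hK'n x hx, S.const (cyc i) x (hF i)]
      · exact hK i
      · intro w hw hws
        have : w = cyc i := hs ⟨hws, hsub hw⟩
        exact hF i (this ▸ hw)
  · refine S.mixing_refine hsub (fun x z hx hz => ?_) fun x hx => ?_
    · obtain ⟨x', hx', hxF'⟩ := ((infinite_inter_branchPoints (isOpen_piece S.finite x)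
        ⟨x, mem_piece_self hx⟩).sdiff hfin).nonempty
      exact ⟨x', hx'.1, hxF', by rwa [hK'n x' hxF', S.const x x' hx hx'.1]⟩
    · obtain ⟨z, hz, hzF⟩ := S.exists_mem_K (hnS hx)
      exact ⟨z, hzF, by rw [hK'n x hx]; exact S.sat x z (hnS hx) hz hzF⟩
  · intro x
    change K' x ⊆ S.K x
    by_cases hx : x ∈ F'
    · rw [hK'm x hx]
      rcases hx with hx | ⟨i, rfl⟩
      · rw [S.K_of_mem x hx, hfF x hx]
      · rw [hfc]; exact singleton_subset_iff.2 (hK i)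
    · rw [hK'n x hx]

open Classical in
/-- Subdivide the piece of a non-branch point `y`, sending `y` to a common point of two sets
covering the constraint of the piece. -/
lemma exists_split (S : State D) {y v u : D} (hy : y ∉ S.F) (hyB : y ∉ branchPoints D)
    (hv : v ∈ S.F) {A B : Set D} (hAB : A ∪ B = S.K y) (hvA : v ∈ A) (hvB : v ∈ B)
    (hAcl : IsClosed A) (hBcl : IsClosed B) (hAcv : Convex A) (hBcv : Convex B)
    (hAsat : ∀ z ∈ A, z ∉ S.F → piece S.F z ⊆ A) (hBsat : ∀ z ∈ B, z ∉ S.F → piece S.F z ⊆ B)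
    (hAne : ∃ z ∈ A, z ∉ S.F) (hBne : ∃ z ∈ B, z ∉ S.F)
    (hadjA : ∀ c ∈ S.F, seg c y ∩ S.F ⊆ {c} → y ∉ seg u c → S.f c ∈ A)
    (hadjB : ∀ c ∈ S.F, seg c y ∩ S.F ⊆ {c} → y ∈ seg u c → S.f c ∈ B)
    (hUne : ∃ z ∈ piece S.F y, y ∉ seg u z) (hVne : ∃ z ∈ piece S.F y, y ∈ seg u z ∧ z ≠ y) :
    ∃ T, S ≤ T ∧ T.F = insert y S.F ∧ (∀ x, x ∉ piece S.F y → T.K x = S.K x) ∧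
      (∀ x ∈ piece S.F y, y ∉ seg u x → T.K x = A) ∧
      (∀ x ∈ piece S.F y, y ∈ seg u x → x ≠ y → T.K x = B) ∧ T.f y = v := by
  set f' := Function.update S.f y v with hf'
  have hfF : ∀ x ∈ S.F, f' x = S.f x := fun x hx =>
    Function.update_of_ne (by rintro rfl; exact hy hx) _ _
  have hfy : f' y = v := Function.update_self _ _ _
  set F' := insert y S.F with hF'
  set K' : D → Set D := fun x => if x ∈ F' then {f' x} else if x ∈ piece S.F y then
    if y ∈ seg u x then B else A else S.K x with hK'
  have hsub : S.F ⊆ F' := subset_insert _ _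
  have hnS : ∀ {x}, x ∉ F' → x ∉ S.F := fun hx h => hx (hsub h)
  have hK'm : ∀ x ∈ F', K' x = {f' x} := fun x hx => if_pos hx
  have hK'n : ∀ x, x ∉ piece S.F y → K' x = S.K x := by
    intro x hx
    by_cases hxF : x ∈ F'
    · rw [hK'm x hxF]
      rcases hxF with rfl | hxF
      · exact absurd (mem_piece_self hy) hx
      · rw [hfF x hxF, S.K_of_mem x hxF]
    · simp only [hK']; rw [if_neg hxF, if_neg hx]
  have hpF : ∀ {x}, x ∈ piece S.F y → x ≠ y → x ∉ F' := fun hx hxy h =>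
    h.elim hxy (not_mem_of_mem_piece hx)
  have hyu : y ∈ seg u y := right_mem_seg u y
  have hK'A : ∀ x ∈ piece S.F y, y ∉ seg u x → K' x = A := by
    intro x hx hxu
    simp only [hK']
    rw [if_neg (hpF hx (by rintro rfl; exact hxu hyu)), if_pos hx, if_neg hxu]
  have hK'B : ∀ x ∈ piece S.F y, y ∈ seg u x → x ≠ y → K' x = B := by
    intro x hx hxu hxy
    simp only [hK']
    rw [if_neg (hpF hx hxy), if_pos hx, if_pos hxu]
  have hA : A ⊆ S.K y := hAB ▸ subset_union_left
  have hB : B ⊆ S.K y := hAB ▸ subset_union_right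
  have hside : ∀ {x z}, y ∉ seg x z → (y ∈ seg u x ↔ y ∈ seg u z) := fun {x z} h =>
    ⟨fun h' => (seg_subset_union u z x h').resolve_right fun h'' => h (mem_seg_comm h''),
      fun h' => (seg_subset_union u x z h').resolve_right h⟩
  have hcases : ∀ x, (x ∈ F' ∧ K' x = {f' x}) ∨ (x ∉ F' ∧ x ∈ piece S.F y ∧ y ∉ seg u x ∧
      K' x = A) ∨ (x ∉ F' ∧ x ∈ piece S.F y ∧ y ∈ seg u x ∧ K' x = B) ∨
      (x ∉ F' ∧ x ∉ piece S.F y ∧ K' x = S.K x) := by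
    intro x
    by_cases hxF : x ∈ F'
    · exact Or.inl ⟨hxF, hK'm x hxF⟩
    by_cases hx : x ∈ piece S.F y
    · by_cases hxu : y ∈ seg u x
      · exact Or.inr (Or.inr (Or.inl ⟨hxF, hx, hxu, hK'B x hx hxu
          (by rintro rfl; exact hxF (Or.inl rfl))⟩))
      · exact Or.inr (Or.inl ⟨hxF, hx, hxu, hK'A x hx hxu⟩)
    · exact Or.inr (Or.inr (Or.inr ⟨hxF, hx, hK'n x hx⟩))
  have hcls : ∀ P : Set D → Prop, (∀ x, P {x}) → P A → P B → (∀ x, P (S.K x)) →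
      ∀ x, P (K' x) := by
    intro P h1 h2 h3 h4 x
    rcases hcases x with ⟨-, h⟩ | ⟨-, -, -, h⟩ | ⟨-, -, -, h⟩ | ⟨-, -, h⟩ <;> rw [h]
    exacts [h1 _, h2, h3, h4 _]
  refine ⟨⟨F', f', K', S.finite.insert y, S.nonempty.mono hsub, ?_, hK'm, ?_, ?_, ?_, ?_, ?_, ?_,
    ?_⟩, ⟨hsub, ?_⟩, rfl, hK'n, hK'A, hK'B, hfy⟩
  · rintro _ (rfl | hx)
    · rw [hfy]; exact Or.inr hv
    · rw [hfF _ hx]; exact Or.inr (S.map _ hx)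
  · rintro _ (rfl | hx) hxB
    · exact absurd hxB hyB
    · obtain ⟨n, hn, h⟩ := S.periodic _ hx hxB
      exact ⟨n, hn, by rw [iterate_eq hfF hx, h]⟩
  · exact hcls _ (fun _ => isClosed_singleton) hAcl hBcl S.closed
  · refine hcls _ (fun x => ?_) hAcv hBcv S.convex
    rintro a rfl b rfl c hc
    exact eq_of_mem_seg_self hc
  · intro x z hx hz hzF
    refine (piece_anti hsub z).trans ?_
    rcases hcases x with ⟨h, -⟩ | ⟨-, -, -, h⟩ | ⟨-, -, -, h⟩ | ⟨-, -, h⟩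
    · exact absurd h hx
    · rw [h] at hz ⊢; exact hAsat z hz (hnS hzF)
    · rw [h] at hz ⊢; exact hBsat z hz (hnS hzF)
    · rw [h] at hz ⊢; exact S.sat x z (hnS hx) hz (hnS hzF)
  · intro x z hx hz
    have hz1 : z ∈ piece S.F x := piece_anti hsub x hz
    have hz2 : y ∉ seg x z := hz y (Or.inl rfl)
    have hzF : z ∉ F' := not_mem_of_mem_piece hz
    rcases hcases x with ⟨h, -⟩ | ⟨-, h1, h2, h⟩ | ⟨-, h1, h2, h⟩ | ⟨-, h1, h⟩
    · exact absurd h hx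
    · rw [h, hK'A z (mem_piece_trans h1 hz1) fun h' => h2 ((hside hz2).2 h')]
    · rw [h, hK'B z (mem_piece_trans h1 hz1) ((hside hz2).1 h2)
        (by rintro rfl; exact hzF (Or.inl rfl))]
    · rw [h, hK'n z fun h' => h1 (mem_piece_trans h' (mem_piece_symm hz1)),
        S.const x z (hnS hx) hz1]
  · rintro c x hc hx hs
    have hsS : seg c x ∩ S.F ⊆ {c} := (inter_subset_inter_right _ hsub).trans hs
    rcases hc with rfl | hc
    · have hxc : x ∈ piece S.F c := fun w hw hws => by
        have : w = c := hsS ⟨hws, hw⟩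
        exact hy (this ▸ hw)
      rw [hfy]
      rcases hcases x with ⟨h, -⟩ | ⟨-, h1, h2, h⟩ | ⟨-, h1, h2, h⟩ | ⟨-, h1, h⟩
      · exact absurd h hx
      · rwa [h]
      · rwa [h]
      · exact absurd hxc h1
    · have hyc : y ∉ seg c x := fun h => by
        have : y = c := hs ⟨h, Or.inl rfl⟩
        exact hy (this ▸ hc)
      have had : x ∈ piece S.F y → seg c y ∩ S.F ⊆ {c} := fun h1 w hw =>
        (seg_subset_union c x y hw.1).elim (fun h => hsS ⟨h, hw.2⟩)
          fun h => absurd (mem_seg_comm h) (h1 w hw.2)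
      rw [hfF c hc]
      rcases hcases x with ⟨h, -⟩ | ⟨-, h1, h2, h⟩ | ⟨-, h1, h2, h⟩ | ⟨-, h1, h⟩
      · exact absurd h hx
      · rw [h]; exact hadjA c hc (had h1) fun h' => h2 ((hside hyc).1 h')
      · rw [h]; exact hadjB c hc (had h1) ((hside hyc).2 h2)
      · rw [h]; exact S.adj c x hc (hnS hx) hsS
  · refine S.mixing_refine hsub (fun x z hx hz => ?_) fun x hx => ?_
    · by_cases hxP : x ∈ piece S.F y
      · rw [S.const y x hy hxP, ← hAB] at hz
        rw [← piece_eq (mem_piece_symm hxP)]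
        rcases hz with hz | hz
        · obtain ⟨a, ha, hau⟩ := hUne
          exact ⟨a, ha, hpF ha (by rintro rfl; exact hau hyu), by rwa [hK'A a ha hau]⟩
        · obtain ⟨a, ha, hau, hay⟩ := hVne
          exact ⟨a, ha, hpF ha hay, by rwa [hK'B a ha hau hay]⟩
      · refine ⟨x, mem_piece_self hx, ?_, by rwa [hK'n x hxP]⟩
        rintro (rfl | h)
        exacts [hxP (mem_piece_self hy), hx h]
    · rcases hcases x with ⟨h, -⟩ | ⟨-, h1, h2, h⟩ | ⟨-, h1, h2, h⟩ | ⟨-, h1, h⟩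
      · exact absurd h hx
      · obtain ⟨z, hz, hzF⟩ := hAne
        exact ⟨z, hzF, h ▸ hAsat z hz hzF⟩
      · obtain ⟨z, hz, hzF⟩ := hBne
        exact ⟨z, hzF, h ▸ hBsat z hz hzF⟩
      · obtain ⟨z, hz, hzF⟩ := S.exists_mem_K (hnS hx)
        exact ⟨z, hzF, h ▸ S.sat x z (hnS hx) hz hzF⟩
  · intro x
    change K' x ⊆ S.K x
    rcases hcases x with ⟨h1, h⟩ | ⟨-, h1, -, h⟩ | ⟨-, h1, -, h⟩ | ⟨-, -, h⟩ <;> rw [h]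
    · rcases h1 with rfl | h1
      · rw [hfy]; exact singleton_subset_iff.2 (hA hvA)
      · rw [hfF x h1, S.K_of_mem x h1]
    · rw [S.const y x hy h1]; exact hA
    · rw [S.const y x hy h1]; exact hB

end State

end States

section Orbits

lemma exists_injective_of_infinite {ι X : Type*} [Finite ι] (i₀ : ι) (x : X) {t : ι → Set X}
    (ht : ∀ i, (t i).Infinite) :
    ∃ u : ι → X, Function.Injective u ∧ u i₀ = x ∧ ∀ i ≠ i₀, u i ∈ t i := by
  classical
  have := Fintype.ofFinite ι
  have h : ∀ i, ∃ s : Finset X, (s : Set X) ⊆ t i \ {x} ∧ s.card = Fintype.card ι := fun i =>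
    ((ht i).sdiff (finite_singleton x)).exists_subset_card_eq _
  choose s hs hcard using h
  obtain ⟨u, hu, hus⟩ := (Finset.all_card_le_biUnion_card_iff_exists_injective s).1 fun A => by
    rcases A.eq_empty_or_nonempty with rfl | ⟨i, hi⟩
    · simp
    · exact (Finset.card_le_univ A).trans
        ((hcard i).ge.trans (Finset.card_le_card (Finset.subset_biUnion_of_mem s hi)))
  refine ⟨Function.update u i₀ x, ?_, Function.update_self _ _ _, fun i hi => ?_⟩
  · intro i j hij
    have hne : ∀ k, u k ≠ x := fun k h => (hs k (hus k)).2 h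
    simp only [Function.update_apply] at hij
    split_ifs at hij with h1 h2 h2
    · rw [h1, h2]
    · exact absurd hij.symm (hne j)
    · exact absurd hij (hne i)
    · exact hu hij
  · rw [Function.update_of_ne hi]; exact (hs i (hus i)).1

variable {D : Type*} [MetricSpace D] [CompactSpace D] [ConnectedSpace D] [IsFine D] [Nontrivial D]

namespace State

open Classical in
instance : Nonempty (State D) := by
  obtain ⟨o⟩ := (inferInstance : Nonempty D)
  refine ⟨⟨{o}, id, fun x => if x ∈ ({o} : Set D) then {o} else univ, finite_singleton o,
    singleton_nonempty o, fun x hx => hx, ?_, fun x _ _ => ⟨1, le_rfl, rfl⟩, ?_, ?_, ?_, ?_, ?_,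
    1, ?_⟩⟩
  · rintro x rfl; simp
  · intro x; split_ifs
    exacts [isClosed_singleton, isClosed_univ]
  · intro x; split_ifs
    · rintro a rfl b rfl c hc
      exact eq_of_mem_seg_self hc
    · exact fun _ _ _ _ => subset_univ _
  · intro x y hx _ _
    rw [if_neg hx]; exact subset_univ _
  · intro x y hx hy
    rw [if_neg hx, if_neg (not_mem_of_mem_piece hy)]
  · intro c x _ hx _
    rw [if_neg hx]; exact mem_univ _
  · intro m hm x y hx hy
    induction m, hm using Nat.le_induction generalizing x with
    | base => exact ⟨y, by simp [hx], hy, rfl⟩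
    | succ m _ ih => exact ⟨y, by simp [hx], hy, ih y hy⟩

/-- A closed path through a branch point can be realized by a periodic orbit. -/
lemma exists_cycle_of_path (S : State D) {x : D} (hx : x ∉ S.F) {m : ℕ}
    (hm : 1 ≤ m) {s : ℕ → D} (h0 : s 0 = x) (hsm : s m = x)
    (hs : ∀ i < m, s (i + 1) ∈ S.K (s i) ∧ s (i + 1) ∉ S.F) {W : ℕ → Set D}
    (hW : ∀ i, IsOpen (W i)) (hsW : ∀ i, s i ∈ W i) :
    ∃ T, S ≤ T ∧ x ∈ T.F ∧ ∀ i, 0 < i → i < m → T.f^[i] x ∈ W i := by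
  have : NeZero m := ⟨by omega⟩
  have hsF : ∀ i ≤ m, s i ∉ S.F := fun i hi => by
    cases i with
    | zero => rwa [h0]
    | succ i => exact (hs i hi).2
  obtain ⟨u, hu, hu0, hut⟩ := exists_injective_of_infinite (0 : ZMod m) x
    (t := fun i => (piece S.F (s i.val) ∩ W i.val ∩ (S.F)ᶜ) ∩ branchPoints D) fun i =>
      infinite_inter_branchPoints (((isOpen_piece S.finite _).inter (hW _)).inter
        S.finite.isClosed.isOpen_compl)
        ⟨s i.val, ⟨mem_piece_self (hsF _ i.val_lt.le), hsW _⟩, hsF _ i.val_lt.le⟩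
  have hup : ∀ i, u i ∈ piece S.F (s i.val) := fun i => by
    by_cases hi : i = 0
    · rw [hi, hu0, ZMod.val_zero, h0]; exact mem_piece_self hx
    · exact (hut i hi).1.1.1
  obtain ⟨T, hST, hTF, -, hT⟩ := S.exists_cycle u hu (fun i => not_mem_of_mem_piece (hup i)) (by
    intro i
    have h1 := hs i.val i.val_lt
    have h2 : s (i + 1).val = s (i.val + 1) := by
      rw [ZMod.val_add, ZMod.val_one_eq_one_mod, Nat.add_mod_mod]
      rcases (show i.val + 1 ≤ m from i.val_lt).lt_or_eq with h | h
      · rw [Nat.mod_eq_of_lt h]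
      · rw [h, Nat.mod_self, h0, hsm]
    rw [S.const _ _ (hsF _ i.val_lt.le) (hup i)]
    exact S.sat _ _ (hsF _ i.val_lt.le) h1.1 h1.2 (h2 ▸ hup (i + 1)))
  refine ⟨T, hST, hTF ▸ Or.inr ⟨0, hu0⟩, fun i hi him => ?_⟩
  rw [← hu0, hT, zero_add]
  have hv : (i : ZMod m).val = i := ZMod.val_cast_of_lt him
  have := (hut i fun h => by rw [h, ZMod.val_zero] at hv; omega).1.1.2
  rwa [hv] at this

lemma exists_mem (S : State D) (x : D) : ∃ T, S ≤ T ∧ x ∈ T.F := by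
  by_cases hx : x ∈ S.F
  · exact ⟨S, le_rfl, hx⟩
  obtain ⟨N, hN⟩ := S.mixing
  obtain ⟨s, h0, hm, hs⟩ := (hN (N + 1) (by omega) x x hx hx).exists_path
  obtain ⟨T, hT, hxT, -⟩ := S.exists_cycle_of_path hx (by omega) h0 hm hs
    (fun _ => isOpen_univ) (fun _ => mem_univ _)
  exact ⟨T, hT, hxT⟩

lemma exists_subset (S : State D) {G : Set D} (hG : G.Finite) : ∃ T, S ≤ T ∧ G ⊆ T.F := by
  induction G, hG using Set.Finite.induction_on with
  | empty => exact ⟨S, le_rfl, empty_subset _⟩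
  | insert _ _ ih =>
    obtain ⟨T, hT, hG⟩ := ih
    obtain ⟨T', hT', hx⟩ := T.exists_mem _
    exact ⟨T', hT.trans hT', insert_subset hx (hG.trans hT'.1)⟩

lemma exists_orbit_meets (S : State D) {a b : D} (hab : a ≠ b) {V : Set D} (hV : IsOpen V)
    (hne : V.Nonempty) {p : ℕ} (hp : 1 ≤ p) :
    ∃ T, S ≤ T ∧ ∃ x ∈ T.F, x ∈ seg a b ∧ ∃ k, T.f^[p * k] x ∈ V := by
  obtain ⟨N, hN⟩ := S.mixing
  obtain ⟨x, -, hxs, hx, -⟩ := exists_branchPoint_seg hab S.finite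
  obtain ⟨w, hw, hwF⟩ := ((infinite_inter_branchPoints hV hne).sdiff S.finite).nonempty
  obtain ⟨n, hn⟩ : ∃ n, n = p * (N + 1) := ⟨_, rfl⟩
  have hnN : N + 1 ≤ n := hn ▸ Nat.le_mul_of_pos_left _ hp
  obtain ⟨s, h0, h1, hs⟩ := (hN n (by omega) x w hx hwF).exists_path
  obtain ⟨s', h0', h1', hs'⟩ := (hN (N + 1) (by omega) w x hwF hx).exists_path
  obtain ⟨T, hT, hxT, h⟩ := S.exists_cycle_of_path hx (m := n + (N + 1)) (by omega)
    (s := fun i => if i ≤ n then s i else s' (i - n)) (by simp [h0]) (by simp [h1'])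
    (fun i hi => by
      rcases lt_trichotomy i n with h | h | h
      · rw [if_pos (by omega), if_pos (by omega)]; exact hs i h
      · have := hs' 0 (by omega)
        rw [if_neg (show ¬ i + 1 ≤ n by omega), if_pos h.le, show i + 1 - n = 0 + 1 by omega,
          show s i = s' 0 by rw [h, h1, h0']]
        exact this
      · have := hs' (i - n) (by omega)
        rw [if_neg (by omega), if_neg (by omega), show i + 1 - n = i - n + 1 by omega]
        exact this)
    (W := fun i => {y | i = n → y ∈ V}) (fun i => by
      by_cases h : i = n
      · simpa [h] using hV
      · simp [h]) (fun i => by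
      rintro rfl
      simpa [h1] using hw.1)
  exact ⟨T, hT, x, hxT, hxs, N + 1, hn ▸ h n (by omega) (by omega) rfl⟩

end State

end Orbits

section Pieces

variable {D : Type*} [TopologicalSpace D]

/-- The pieces into which a finite set cuts a set. -/
def pieces (F K : Set D) : Set (Set D) := {P | ∃ x ∈ K, x ∉ F ∧ P = piece F x}

lemma finite_pieces [IsFine D] {F : Set D} (hF : F.Finite) (K : Set D) : (pieces F K).Finite := by
  have h : {P | ∃ x ∉ F, P = piece F x}.Finite := by
    induction F, hF using Set.Finite.induction_on with
    | empty =>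
      refine (finite_singleton univ).subset ?_
      rintro _ ⟨x, -, rfl⟩
      exact eq_univ_of_forall fun y z hz => absurd hz (notMem_empty z)
    | @insert c F _ _ ih =>
      refine (Finite.image2 (fun P Q => P ∩ Q) ih (IsFine.fin c)).subset ?_
      rintro _ ⟨x, hx, rfl⟩
      have hxc : x ≠ c := fun h => hx (Or.inl h)
      refine ⟨_, ⟨x, fun h => hx (Or.inr h), rfl⟩, _, ⟨x, hxc, rfl⟩, ?_⟩
      ext y
      simp [piece, mem_connectedComponentIn_iff hxc, and_comm]
  exact h.subset fun _ ⟨x, _, hx, h⟩ => ⟨x, hx, h⟩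

lemma piece_eq_of_subset_union {F F' : Set D} {x z : D} (h : F ⊆ F') (h' : F' ⊆ F ∪ piece F z)
    (hx : x ∉ F) (hxz : x ∉ piece F z) : piece F' x = piece F x := by
  refine (piece_anti h x).antisymm fun y hy w hw hws => ?_
  have hwx : w ∈ piece F x := piece_inter_convex F x x (mem_piece_self hx) y hy hws
  rcases h' hw with h1 | h1
  · exact not_mem_of_mem_piece hwx h1
  · exact hxz (mem_piece_trans h1 (mem_piece_symm hwx))

end Pieces

section Shrinking

variable {D : Type*} [MetricSpace D] [CompactSpace D] [ConnectedSpace D] [IsFine D]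

lemma adj_of_adj {F : Set D} {c x y : D} (h : seg c y ∩ F ⊆ {c}) (hxy : y ∈ piece F x) :
    seg c x ∩ F ⊆ {c} := fun w hw =>
  (seg_subset_union c y x hw.1).elim (fun h' => h ⟨h', hw.2⟩)
    fun h' => absurd (mem_seg_comm h') (hxy w hw.2)

/-- A cut point of the piece of `p` close to a boundary point `c` of the piece. -/
lemma exists_collar {F : Set D} (hF : F.Finite) {c p : D} (hp : p ∉ F) (hc : c ∈ F)
    (hcp : seg c p ∩ F ⊆ {c}) : ∃ y ∈ piece F p, y ∉ branchPoints D ∧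
      (∀ d ∈ F, seg d y ∩ F ⊆ {d} → y ∉ seg c d → d = c) ∧
      (∃ z ∈ piece F y, y ∉ seg c z) ∧ ∃ z ∈ piece F y, y ∈ seg c z ∧ z ≠ y := by
  have hne : c ≠ p := by rintro rfl; exact hp hc
  obtain ⟨y, hy, hyO, hyc, hyp, hyB⟩ := exists_near hne
    (O := ⋂ d ∈ {d ∈ F | seg d p ∩ F ⊆ {d} ∧ d ≠ c}, (seg d p)ᶜ)
    ((hF.subset (sep_subset _ _)).isOpen_biInter fun d _ => (isClosed_seg d p).isOpen_compl)
    (mem_iInter₂.2 fun d hd h => hd.2.2 (hd.2.1 ⟨h, hc⟩).symm)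
  have hyP : y ∈ piece F p := by
    intro w hw hws
    have hwc : w = c := hcp ⟨seg_subset_seg (right_mem_seg c p) hy hws, hw⟩
    exact hyc (seg_antisymm (mem_seg_comm hy) (hwc ▸ hws))
  refine ⟨y, hyP, hyB, fun d hd hdy hyd => ?_, ?_,
    p, mem_piece_symm hyP, hy, hyp.symm⟩
  · by_contra hdc
    exact (seg_subset_union c d p hy).elim hyd
      (mem_iInter₂.1 hyO d ⟨hd, adj_of_adj hdy hyP, hdc⟩)
  · obtain ⟨z, hz, hzO, hzy, -⟩ := exists_near hyc (isOpen_piece hF y)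
      (mem_piece_self (not_mem_of_mem_piece hyP))
    exact ⟨z, hzO, fun h => hzy (seg_antisymm (mem_seg_comm hz) h)⟩

/-- A cut point of the piece of `p` with one side disjoint from `F`. -/
lemma exists_end {F : Set D} (hF : F.Finite) (hFne : F.Nonempty) {p : D} (hp : p ∉ F) :
    ∃ y ∈ piece F p, y ∉ branchPoints D ∧ ∃ u, (∀ d ∈ F, y ∈ seg u d) ∧
      (∃ z ∈ piece F y, y ∉ seg u z) ∧ ∃ z ∈ piece F y, y ∈ seg u z ∧ z ≠ y := by
  obtain ⟨e, he, heP⟩ := IsFine.dense.exists_mem_open (isOpen_piece hF p)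
    ⟨p, mem_piece_self hp⟩
  have heF : e ∉ F := not_mem_of_mem_piece heP
  obtain ⟨c, hc⟩ := hFne
  have hne : ∀ d ∈ F, d ≠ e := by rintro d hd rfl; exact heF hd
  obtain ⟨y, hy, hyO, hye, hyc, hyB⟩ := exists_near (hne c hc).symm
    (O := piece F p ∩ ⋂ d ∈ F, (seg d c)ᶜ)
    ((isOpen_piece hF p).inter (hF.isOpen_biInter fun d _ => (isClosed_seg d c).isOpen_compl))
    ⟨heP, mem_iInter₂.2 fun d hd h =>
      not_mem_seg_of_isEndpoint he (hne d hd) (hne c hc) h⟩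
  refine ⟨y, hyO.1, hyB, e, fun d hd => (seg_subset_union e d c hy).resolve_right
    (mem_iInter₂.1 hyO.2 d hd), ⟨e, piece_eq hyO.1 ▸ heP, fun h => hye (eq_of_mem_seg_self h)⟩, ?_⟩
  obtain ⟨z, hz, hzO, hzy, -⟩ := exists_near hyc (isOpen_piece hF y)
    (mem_piece_self (not_mem_of_mem_piece hyO.1))
  exact ⟨z, hzO, (seg_subset_union e z c hy).resolve_right fun h =>
    hzy (seg_antisymm (mem_seg_comm hz) (mem_seg_comm h)), hzy⟩

variable [Nontrivial D]

namespace State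

/-- The constraints on the piece of `p` can be made of size less than `ε` by changing the state
only in this piece. -/
def Shrinks (ε : ℝ) (T : State D) (p : D) : Prop :=
  ∃ T', T ≤ T' ∧ (∀ x, x ∉ piece T.F p → T'.K x = T.K x) ∧ T'.F ⊆ T.F ∪ piece T.F p ∧
    ∀ z ∈ piece T.F p, ∀ s ∈ T'.K z, ∀ t ∈ T'.K z, dist s t < ε

lemma dist_lt_of_mem {ε : ℝ} (hε : 0 < ε) (T : State D) {x : D} (hx : x ∈ T.F) :
    ∀ s ∈ T.K x, ∀ t ∈ T.K x, dist s t < ε := by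
  rw [T.K_of_mem x hx]
  rintro s rfl t rfl
  rwa [dist_self]

lemma Shrinks.congr {ε : ℝ} {T : State D} {p q : D} (h : Shrinks ε T p) (hq : q ∈ piece T.F p) :
    Shrinks ε T q := by
  unfold Shrinks at *; rwa [piece_eq hq]

lemma shrinks_of_split {ε : ℝ} (hε : 0 < ε) {T T₁ : State D} {y u z w : D}
    (hyB : y ∉ branchPoints D) (hT : T ≤ T₁) (hF : T₁.F = insert y T.F)
    (hK : ∀ x, x ∉ piece T.F y → T₁.K x = T.K x)
    (hz : z ∈ piece T.F y) (hyz : y ∉ seg u z) (hw : w ∈ piece T.F y) (hyw : y ∈ seg u w)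
    (hwy : w ≠ y) (h₁ : Shrinks ε T₁ z)
    (h₂ : ∀ T₂ : State D, T₁ ≤ T₂ → (∀ x, x ∉ piece T₁.F z → T₂.K x = T₁.K x) →
      T₂.F ⊆ T₁.F ∪ piece T₁.F z → w ∉ T₂.F → Shrinks ε T₂ w) : Shrinks ε T y := by
  obtain ⟨T₂, h12, hK2, hF2, hs2⟩ := h₁
  have hyu : u ≠ y := by rintro rfl; exact hyz (left_mem_seg u z)
  have hsub : T.F ⊆ T₁.F := hT.1
  have hwz : w ∉ piece T₁.F z := fun h => (seg_subset_union u z w hyw).elim hyz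
    (h y (hF ▸ Or.inl rfl))
  have hwF1 : w ∉ T₁.F := by
    rw [hF]; rintro (h | h)
    exacts [hwy h, not_mem_of_mem_piece hw h]
  have hwF : w ∉ T₂.F := fun h => (hF2 h).elim hwF1 hwz
  have hpw : piece T₂.F w = piece T₁.F w := piece_eq_of_subset_union h12.1 hF2 hwF1 hwz
  obtain ⟨T₃, h23, hK3, hF3, hs3⟩ := h₂ T₂ h12 hK2 hF2 hwF
  rw [hpw] at hK3 hF3 hs3
  have hzP : piece T₁.F z ⊆ piece T.F y := (piece_anti hsub z).trans (piece_eq hz).subset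
  have hwP : piece T₁.F w ⊆ piece T.F y := (piece_anti hsub w).trans (piece_eq hw).subset
  refine ⟨T₃, (hT.trans h12).trans h23, fun x hx => ?_, fun x hx => ?_, fun x hx => ?_⟩
  · rw [hK3 x fun h => hx (hwP h), hK2 x fun h => hx (hzP h), hK x hx]
  · rcases hF3 hx with h | h
    · rcases hF2 h with h | h
      · rw [hF] at h
        rcases h with rfl | h
        · exact Or.inr (mem_piece_trans hz (mem_piece_symm hz))
        · exact Or.inl h
      · exact Or.inr (hzP h)
    · exact Or.inr (hwP h)
  · by_cases hxy : x = y
    · exact dist_lt_of_mem hε T₃ (h23.1 (h12.1 (by rw [hF, hxy]; exact Or.inl rfl)))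
    by_cases hxu : y ∈ seg u x
    · refine hs3 x fun v hv hvs => ?_
      rw [hF] at hv
      rcases hv with rfl | hv
      · exact hyB (mem_branchPoints hyw hxu hvs hyu hwy hxy)
      · exact mem_piece_trans (mem_piece_symm hw) hx v hv hvs
    · have hxz : x ∈ piece T₁.F z := by
        intro v hv hvs
        rw [hF] at hv
        rcases hv with rfl | hv
        · exact (seg_subset_union z u x hvs).elim (fun h => hyz (mem_seg_comm h)) hxu
        · exact mem_piece_trans (mem_piece_symm hz) hx v hv hvs
      rw [hK3 x fun h => hwz (mem_piece_trans hxz (mem_piece_symm h))]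
      exact hs2 x hxz

lemma shrinks_of_cover {ε : ℝ} (hε : 0 < ε) {G K A B : Set D} {v : D} (hv : v ∈ G)
    (hAB : A ∪ B = K) (hvA : v ∈ A) (hvB : v ∈ B)
    (hAcl : IsClosed A) (hBcl : IsClosed B) (hAcv : Convex A) (hBcv : Convex B)
    (hAsat : ∀ z ∈ A, z ∉ G → piece G z ⊆ A) (hBsat : ∀ z ∈ B, z ∉ G → piece G z ⊆ B)
    (hAne : ∃ z ∈ A, z ∉ G) (hBne : ∃ z ∈ B, z ∉ G)
    (hA : ∀ (T : State D) p, G ⊆ T.F → p ∉ T.F → T.K p = A → Shrinks ε T p)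
    (hB : ∀ (T : State D) p, G ⊆ T.F → p ∉ T.F → T.K p = B → Shrinks ε T p)
    (T : State D) (p : D) (hG : G ⊆ T.F) (hp : p ∉ T.F) (hK : T.K p = K) : Shrinks ε T p := by
  have hsat : ∀ {X : Set D}, (∀ z ∈ X, z ∉ G → piece G z ⊆ X) → ∀ {T : State D}, G ⊆ T.F →
      ∀ z ∈ X, z ∉ T.F → piece T.F z ⊆ X := fun {X} h T hG z hz hzF =>
    (piece_anti hG z).trans (h z hz fun h => hzF (hG h))
  have hne : ∀ {X : Set D}, (∀ z ∈ X, z ∉ G → piece G z ⊆ X) → (∃ z ∈ X, z ∉ G) →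
      ∀ {T : State D}, G ⊆ T.F → ∃ z ∈ X, z ∉ T.F := fun {X} h hX T hG => by
    obtain ⟨z, hz, hzG⟩ := hX
    obtain ⟨a, ha, haF⟩ := ((infinite_inter_branchPoints
      (isOpen_piece (T.finite.subset hG) z) ⟨z, mem_piece_self hzG⟩).sdiff T.finite).nonempty
    exact ⟨a, h z hz hzG ha.1, haF⟩
  induction hr : {c | c ∈ T.F ∧ seg c p ∩ T.F ⊆ {c} ∧ T.f c ∉ A}.ncard using
    Nat.strong_induction_on generalizing T p with
  | _ r ih =>
  subst hr
  by_cases hall : ∀ c ∈ T.F, seg c p ∩ T.F ⊆ {c} → T.f c ∈ A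
  · obtain ⟨y, hy, hyB, u, hu, ⟨z, hz, hyz⟩, w, hw, hyw, hwy⟩ := exists_end T.finite T.nonempty hp
    obtain ⟨T₁, h1, hF1, hK1, hKz, hKw, -⟩ := T.exists_split (u := u) (v := v)
      (not_mem_of_mem_piece hy) hyB (hG hv) (A := B) (B := A)
      (by rw [union_comm, hAB, T.const p y hp hy, hK]) hvB hvA hBcl hAcl hBcv hAcv
      (hsat hBsat hG) (hsat hAsat hG) (hne hBsat hBne hG) (hne hAsat hAne hG)
      (fun c hc _ h => absurd (hu c hc) h) (fun c hc h _ => hall c hc (adj_of_adj h hy))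
      ⟨z, hz, hyz⟩ ⟨w, hw, hyw, hwy⟩
    refine (shrinks_of_split hε hyB h1 hF1 hK1 hz hyz hw hyw hwy
      (hB _ _ (hG.trans h1.1) ?_ (hKz z hz hyz))
      fun T₂ h2 hK2 _ hwF => hA _ _ ((hG.trans h1.1).trans h2.1) hwF ?_).congr (mem_piece_symm hy)
    · rw [hF1]; rintro (rfl | h)
      exacts [hyz (right_mem_seg u z), not_mem_of_mem_piece hz h]
    · rw [hK2 w fun h => ?_, hKw w hw hyw hwy]
      exact (seg_subset_union u z w hyw).elim hyz (h y (hF1 ▸ Or.inl rfl))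
  · push Not at hall
    obtain ⟨c, hc, hcp, hfc⟩ := hall
    obtain ⟨y, hy, hyB, hu, ⟨z, hz, hyz⟩, w, hw, hyw, hwy⟩ := exists_collar T.finite hp hc hcp
    have hyF : y ∉ T.F := not_mem_of_mem_piece hy
    have hKy : T.K y = K := by rw [T.const p y hp hy, hK]
    have hfcK : T.f c ∈ K := hK ▸ T.adj c p hc hp hcp
    obtain ⟨T₁, h1, hF1, hK1, hKz, hKw, hfy⟩ := T.exists_split (u := c) (v := v)
      hyF hyB (hG hv) (A := B) (B := K)
      (by rw [hKy, ← hAB]; exact union_eq_right.2 subset_union_right) hvB (hAB ▸ Or.inl hvA) hBcl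
      (hK ▸ T.closed p) hBcv (hK ▸ T.convex p)
      (hsat hBsat hG) (hK ▸ fun z => T.sat p z hp) (hne hBsat hBne hG) (hK ▸ T.exists_mem_K hp)
      (fun d hd h h' => by
        rw [hu d hd h h']
        exact (hAB ▸ hfcK : T.f c ∈ A ∪ B).resolve_left hfc)
      (fun d hd h _ => hKy ▸ T.adj d y hd hyF h)
      ⟨z, hz, hyz⟩ ⟨w, hw, hyw, hwy⟩
    refine (shrinks_of_split hε hyB h1 hF1 hK1 hz hyz hw hyw hwy
      (hB _ _ (hG.trans h1.1) ?_ (hKz z hz hyz))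
      fun T₂ h2 hK2 hF2 hwF => ih _ (ncard_lt_ncard ⟨?_, fun h => ?_⟩
        (T.finite.subset (sep_subset _ _))) _ _ ((hG.trans h1.1).trans h2.1) hwF
        ?_ rfl).congr (mem_piece_symm hy)
    · rw [hF1]; rintro (rfl | h)
      exacts [hyz (right_mem_seg c z), not_mem_of_mem_piece hz h]
    · rintro d ⟨hdF, hdw, hfd⟩
      have hd1 : d ∈ T₁.F := by
        refine (hF2 hdF).resolve_right fun hdz => ?_
        have hyd : y ∈ seg d w := by
          by_contra hyd
          refine (seg_subset_union c d w hyw).elim (fun h => ?_) hyd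
          exact (seg_subset_union c z d h).elim hyz (hdz y (hF1 ▸ Or.inl rfl))
        have : y = d := hdw ⟨hyd, h2.1 (hF1 ▸ Or.inl rfl)⟩
        exact not_mem_of_mem_piece hdz (this ▸ hF1 ▸ Or.inl rfl)
      rw [f_eq_of_le h2 hd1] at hfd
      rw [hF1] at hd1
      rcases hd1 with rfl | hd
      · rw [hfy] at hfd; exact absurd hvA hfd
      · exact ⟨hd, adj_of_adj ((inter_subset_inter_right _ (h1.trans h2).1).trans hdw)
          (mem_piece_trans hy hw), f_eq_of_le h1 hd ▸ hfd⟩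
    · obtain ⟨-, hcw, -⟩ := h ⟨hc, hcp, hfc⟩
      have : y = c := hcw ⟨hyw, h2.1 (hF1 ▸ Or.inl rfl)⟩
      exact hyF (this ▸ hc)
    · rw [hK2 w fun h => ?_, hKw w hw hyw hwy]
      exact (seg_subset_union c z w hyw).elim hyz (h y (hF1 ▸ Or.inl rfl))

lemma shrinks {ε : ℝ} (hε : 0 < ε) {G : Set D} (hGfin : G.Finite)
    (hsep : ∀ x y : D, ε ≤ dist x y → ∃ v ∈ G, v ∈ seg x y ∧ v ≠ x ∧ v ≠ y)
    (T : State D) (p : D) (hG : G ⊆ T.F) (hp : p ∉ T.F)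
    (hsat : ∀ z ∈ T.K p, z ∉ G → piece G z ⊆ T.K p) : Shrinks ε T p := by
  induction hn : (pieces G (T.K p)).ncard using Nat.strong_induction_on generalizing T p with
  | _ n ih =>
  subst hn
  by_cases hsmall : ∀ s ∈ T.K p, ∀ t ∈ T.K p, dist s t < ε
  · exact ⟨T, le_rfl, fun _ _ => rfl, subset_union_left, fun z hz => by
      rw [T.const p z hp hz]; exact hsmall⟩
  push Not at hsmall
  obtain ⟨s, hs, t, ht, hst⟩ := hsmall
  obtain ⟨v, hv, hvst, hvs, hvt⟩ := hsep s t hst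
  set K := T.K p with hK
  have hKcv : Convex K := T.convex p
  have hvK : v ∈ K := hKcv s hs t ht hvst
  set C := connectedComponentIn ({v}ᶜ : Set D) s with hC
  have hCm : ∀ x, x ∈ C ↔ v ∉ seg s x := fun x => mem_connectedComponentIn_iff hvs.symm
  set A := K ∩ insert v C with hA
  set B := K ∩ Cᶜ with hB
  have hvC : v ∉ C := fun h => (hCm v).1 h (right_mem_seg s v)
  have hvA : v ∈ A := ⟨hvK, Or.inl rfl⟩
  have hvB : v ∈ B := ⟨hvK, hvC⟩
  have hAB : A ∪ B = K := by
    ext x; by_cases h : x ∈ C <;> simp +contextual [hA, hB, h, hvK]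
  have hdisj : ∀ x ∈ A, x ∈ B → x = v := fun x hx hx' => hx.2.resolve_right hx'.2
  have hAsat : ∀ z ∈ A, z ∉ G → piece G z ⊆ A := fun z hz hzG x hx => by
    refine ⟨hsat z hz.1 hzG hx, Or.inr ((hCm x).2 fun h => ?_)⟩
    have hzC : z ∈ C := hz.2.resolve_left (by rintro rfl; exact hzG hv)
    exact (seg_subset_union s z x h).elim ((hCm z).1 hzC) (hx v hv)
  have hBsat : ∀ z ∈ B, z ∉ G → piece G z ⊆ B := fun z hz hzG x hx => by
    refine ⟨hsat z hz.1 hzG hx, fun h => hz.2 ((hCm z).2 fun h' => ?_)⟩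
    exact (seg_subset_union s x z h').elim ((hCm x).1 h)
      fun h => hx v hv (mem_seg_comm h)
  obtain ⟨a, -, has, haG, -, hav⟩ := exists_branchPoint_seg hvs.symm hGfin
  obtain ⟨b, -, hbt, hbG, -, hbv⟩ := exists_branchPoint_seg hvt.symm hGfin
  have haA : a ∈ A := ⟨hKcv s hs v hvK has, Or.inr ((hCm a).2 fun h =>
    hav (seg_antisymm has h))⟩
  have hbB : b ∈ B := ⟨hKcv t ht v hvK hbt, fun h => (seg_subset_union s b t hvst).elim
    ((hCm b).1 h) fun h => hbv (seg_antisymm hbt (mem_seg_comm h))⟩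
  have hlt : ∀ {X : Set D} {c : D}, X ⊆ K → (∀ z ∈ X, z ∉ G → piece G z ⊆ X) → c ∈ K → c ∉ G →
      c ∉ X → (pieces G X).ncard < (pieces G K).ncard := by
    intro X c hXK hXs hc hcG hcX
    refine ncard_lt_ncard ⟨?_, fun h => ?_⟩ (finite_pieces hGfin K)
    · rintro _ ⟨x, hx, hxG, rfl⟩; exact ⟨x, hXK hx, hxG, rfl⟩
    · obtain ⟨x, hx, hxG, he⟩ := h ⟨c, hc, hcG, rfl⟩
      exact hcX (hXs x hx hxG (he ▸ mem_piece_self hcG))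
  refine shrinks_of_cover hε hv hAB hvA hvB ((T.closed p).inter ?_)
    ((T.closed p).inter (isOpen_component v s).isClosed_compl) ?_ ?_ hAsat hBsat ⟨a, haA, haG⟩
    ⟨b, hbB, hbG⟩ (fun T' q h1 h2 h3 => ?_) (fun T' q h1 h2 h3 => ?_) T p hG hp rfl
  · rw [← closure_component hvs.symm]; exact isClosed_closure
  · exact fun x hx y hy z hz => ⟨hKcv x hx.1 y hy.1 hz,
      seg_subset (isPreconnected_insert_component hvs.symm) hx.2 hy.2 hz⟩
  · refine fun x hx y hy z hz => ⟨hKcv x hx.1 y hy.1 hz, fun h => ?_⟩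
    have h1 : ∀ {x}, x ∉ C → v ∈ seg z x := fun {x} hx => by
      by_contra h'
      exact hx ((hCm x).2 fun h'' => (seg_subset_union s z x h'').elim ((hCm z).1 h) h')
    exact hvC (eq_of_mem_seg_seg hz (mem_seg_comm (h1 hx.2)) (h1 hy.2) ▸ h)
  · exact ih _ (h3 ▸ hlt inter_subset_left hAsat hbB.1 hbG fun h => hbv (hdisj b h hbB)) T' q h1
      h2 (h3 ▸ hAsat) rfl
  · exact ih _ (h3 ▸ hlt inter_subset_left hBsat haA.1 haG fun h => hav (hdisj a haA h)) T' q h1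
      h2 (h3 ▸ hBsat) rfl

lemma exists_small (S : State D) {ε : ℝ} (hε : 0 < ε) :
    ∃ T, S ≤ T ∧ ∀ x, ∀ s ∈ T.K x, ∀ t ∈ T.K x, dist s t < ε := by
  obtain ⟨G, hGfin, -, hsep⟩ := exists_finite_separating (D := D) hε
  obtain ⟨T₀, hST, hGT⟩ := S.exists_subset hGfin
  suffices h : ∀ T : State D, T₀ ≤ T → (∀ x, x ∉ T.F →
      ¬ (∀ s ∈ T.K x, ∀ t ∈ T.K x, dist s t < ε) →
        ∀ z ∈ T.K x, z ∉ T₀.F → piece T₀.F z ⊆ T.K x) →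
      ∃ T', T ≤ T' ∧ ∀ x, ∀ s ∈ T'.K x, ∀ t ∈ T'.K x, dist s t < ε by
    obtain ⟨T, hT, h⟩ := h T₀ le_rfl fun x hx _ z => T₀.sat x z hx
    exact ⟨T, hST.trans hT, h⟩
  intro T hT hsat
  induction hn : (pieces T.F {x | ¬ ∀ s ∈ T.K x, ∀ t ∈ T.K x, dist s t < ε}).ncard using
    Nat.strong_induction_on generalizing T with
  | _ n ih =>
  subst hn
  by_cases hall : ∀ x, ∀ s ∈ T.K x, ∀ t ∈ T.K x, dist s t < ε
  · exact ⟨T, le_rfl, hall⟩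
  obtain ⟨p, hpb⟩ := not_forall.1 hall
  have hp : p ∉ T.F := fun h => hpb (dist_lt_of_mem hε T h)
  obtain ⟨T', hT', hK', hF', hs'⟩ := shrinks hε T₀.finite (fun x y h => by
    obtain ⟨v, hv, h⟩ := hsep x y h
    exact ⟨v, hGT hv, h⟩) T p hT.1 hp (hsat p hp hpb)
  have hbad : ∀ x, (¬ ∀ s ∈ T'.K x, ∀ t ∈ T'.K x, dist s t < ε) → x ∉ piece T.F p := fun x hx h =>
    hx (hs' x h)
  refine (ih _ (ncard_lt_ncard ⟨?_, fun h => ?_⟩ (finite_pieces T.finite _)) T'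
    (hT.trans hT') (fun x hx hb => ?_) rfl).imp fun T'' h => ⟨hT'.trans h.1, h.2⟩
  · rintro _ ⟨x, hx, hxF, rfl⟩
    have hxp := hbad x hx
    have hxF' : x ∉ T.F := fun h => hxF (hT'.1 h)
    refine ⟨x, ?_, hxF', piece_eq_of_subset_union hT'.1 hF' hxF' hxp⟩
    rwa [mem_ofPred_eq, hK' x hxp] at hx
  · obtain ⟨x, hx, hxF, he⟩ := h ⟨p, hpb, hp, rfl⟩
    refine hbad x hx (mem_piece_symm (piece_anti hT'.1 x ?_))
    rw [← he]; exact mem_piece_self hp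
  · have hxp := hbad x hb
    rw [hK' x hxp] at hb ⊢
    exact hsat x (fun h => hx (hT'.1 h)) hb

end State

end Shrinking

section Limit

/-- A countable family of cofinal upward closed requirements is met along a monotone sequence. -/
lemma exists_monotone_seq {P ι : Type*} [Preorder P] [Nonempty P] [Countable ι] (R : ι → P → Prop)
    (hR : ∀ i p, ∃ q, p ≤ q ∧ R i q) : ∃ s : ℕ → P, Monotone s ∧ ∀ i, ∃ n, R i (s n) := by
  have := Encodable.ofCountable ι
  obtain ⟨p⟩ := ‹Nonempty P›
  let C : ι → Order.Cofinal P := fun i => ⟨{q | R i q}, fun p => by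
    obtain ⟨q, hq, h⟩ := hR i p
    exact ⟨q, h, hq⟩⟩
  exact ⟨Order.sequenceOfCofinals p C, Order.sequenceOfCofinals.monotone p C,
    fun i => ⟨_, Order.sequenceOfCofinals.encode_mem p C i⟩⟩

variable {D : Type*} [MetricSpace D] [CompactSpace D] [ConnectedSpace D] [IsFine D] [Nontrivial D]

/-- A monotone sequence of states with shrinking constraints determines a continuous map. -/
lemma exists_continuous_limit {s : ℕ → State D} (hs : Monotone s)
    (hsmall : ∀ k : ℕ, ∃ n, ∀ x, ∀ y ∈ (s n).K x, ∀ z ∈ (s n).K x, dist y z < 1 / ((k : ℝ) + 1)) :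
    ∃ f : D → D, Continuous f ∧ ∀ n, ∀ x ∈ (s n).F, f x = (s n).f x := by
  have hex : ∀ x, ∃ z, ∀ n, z ∈ (s n).K x := fun x => by
    have := IsCompact.nonempty_iInter_of_sequence_nonempty_isCompact_isClosed
      (fun n => (s n).K x) (fun n => (hs n.le_succ).2 x) (fun n => ?_)
      ((s 0).closed x).isCompact fun n => (s n).closed x
    · obtain ⟨z, hz⟩ := this
      exact ⟨z, fun n => mem_iInter.1 hz n⟩
    · by_cases hx : x ∈ (s n).F
      · rw [(s n).K_of_mem x hx]; exact singleton_nonempty _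
      · obtain ⟨z, hz, -⟩ := (s n).exists_mem_K hx
        exact ⟨z, hz⟩
  choose f hf using hex
  refine ⟨f, continuous_iff_continuousAt.2 fun x => Metric.tendsto_nhds.2 fun ε hε => ?_,
    fun n x hx => by simpa [(s n).K_of_mem x hx] using hf x n⟩
  obtain ⟨k, hk⟩ := exists_nat_one_div_lt hε
  obtain ⟨n, hn⟩ := hsmall k
  have hfin : ((s n).F \ {x}).Finite := (s n).finite.subset sdiff_subset
  filter_upwards [(isOpen_piece hfin x).mem_nhds (mem_piece_self (by simp))] with y hy
  by_cases hyx : y = x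
  · rw [hyx, dist_self]; exact hε
  refine (hn y (f y) (hf y n) (f x) ?_).trans hk
  by_cases hx : x ∈ (s n).F
  · have h : f x = (s n).f x := by simpa [(s n).K_of_mem x hx] using hf x n
    rw [h]
    refine (s n).adj x y hx (fun h => hy y ⟨h, hyx⟩ (right_mem_seg x y)) fun z hz => ?_
    by_contra hzx
    exact hy z ⟨hz.2, hzx⟩ hz.1
  · rw [(s n).const x y hx (by rwa [sdiff_singleton_eq_self hx] at hy)]
    exact hf x n

variable (D) in
/-- The limit map: every branch point is periodic and each segment between branch points meets
every open set under iteration along each arithmetic progression `p * k`. -/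
lemma exists_map_meets : ∃ f : D → D, Continuous f ∧ (∀ b ∈ branchPoints D, IsPeriodic f b) ∧
    ∀ a ∈ branchPoints D, ∀ b ∈ branchPoints D, a ≠ b → ∀ V : Set D, IsOpen V → V.Nonempty →
      ∀ p : ℕ, 1 ≤ p → ∃ x ∈ seg a b, ∃ k, f^[p * k] x ∈ V := by
  have hB : Countable (branchPoints D) := countable_branchPoints.to_subtype
  have hC : Countable (countableBasis D) := (countable_countableBasis D).to_subtype
  let I := branchPoints D ⊕ ℕ ⊕ (branchPoints D × branchPoints D × countableBasis D × ℕ)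
  let R : I → State D → Prop := Sum.elim (fun b T => (b : D) ∈ T.F) (Sum.elim
    (fun k T => ∀ x, ∀ y ∈ T.K x, ∀ z ∈ T.K x, dist y z < 1 / ((k : ℝ) + 1))
    (fun i T => (i.1 : D) ≠ i.2.1 → 1 ≤ i.2.2.2 →
      ∃ x ∈ T.F, x ∈ seg (i.1 : D) i.2.1 ∧ ∃ k, T.f^[i.2.2.2 * k] x ∈ (i.2.2.1 : Set D)))
  obtain ⟨s, hs, hR⟩ := exists_monotone_seq R (by
    rintro (b | k | ⟨a, b, V, p⟩) S
    · exact S.exists_mem b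
    · exact S.exists_small (by positivity)
    · by_cases h : (a : D) ≠ b ∧ 1 ≤ p
      · obtain ⟨T, hT, h⟩ := S.exists_orbit_meets h.1 (isOpen_of_mem_countableBasis V.2)
          (nonempty_of_mem_countableBasis V.2) h.2
        exact ⟨T, hT, fun _ _ => h⟩
      · exact ⟨S, le_rfl, fun h1 h2 => (h ⟨h1, h2⟩).elim⟩)
  obtain ⟨f, hf, hfs⟩ := exists_continuous_limit hs fun k => hR (Sum.inr (Sum.inl k))
  refine ⟨f, hf, fun b hb => ?_, fun a ha b hb hab V hV hne p hp => ?_⟩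
  · obtain ⟨n, hn⟩ := hR (Sum.inl ⟨b, hb⟩)
    obtain ⟨m, hm, h⟩ := (s n).periodic b hn hb
    exact ⟨m, hm, (State.iterate_eq (hfs n) hn m).trans h⟩
  · obtain ⟨v, hv⟩ := hne
    obtain ⟨W, hW, -, hWV⟩ := (isBasis_countableBasis D).exists_subset_of_mem_open hv hV
    obtain ⟨n, hn⟩ := hR (Sum.inr (Sum.inr (⟨a, ha⟩, ⟨b, hb⟩, ⟨W, hW⟩, p)))
    obtain ⟨x, hx, hxs, k, hk⟩ := hn hab hp
    exact ⟨x, hxs, k, hWV ((State.iterate_eq (hfs n) hx _).symm ▸ hk)⟩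

lemma exists_seg_subset {x : D} {A : Set D} (hx : x ∈ A) (hA : Convex A) {a : D} (ha : a ∈ A)
    (hxa : x ≠ a) {O : Set D} (hO : IsOpen O) (hxO : x ∈ O) :
    ∃ b ∈ branchPoints D, ∃ c ∈ branchPoints D, b ≠ c ∧ seg b c ⊆ A ∩ O := by
  obtain ⟨Z, hZ, hxZ, hZO⟩ := exists_piece_subset hO hxO
  obtain ⟨y, hy, hyZ, hyx, -, -⟩ := exists_near hxa (isOpen_piece hZ x) (mem_piece_self hxZ)
  obtain ⟨b, hb, hbs, -, -, -⟩ := exists_branchPoint_seg hyx.symm finite_empty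
  obtain ⟨c, hc, hcs, hcb, -, -⟩ := exists_branchPoint_seg hyx.symm (finite_singleton b)
  refine ⟨b, hb, c, hc, fun h => hcb h.symm, fun z hz => ?_⟩
  have hyA := hA x hx a ha hy
  have hcvx := piece_inter_convex Z x
  have hxZ' := mem_piece_self hxZ
  exact ⟨hA b (hA x hx y hyA hbs) c (hA x hx y hyA hcs) hz,
    hZO (hcvx b (hcvx x hxZ' y hyZ hbs) c (hcvx x hxZ' y hyZ hcs) hz)⟩

lemma surjective_of_periodic {f : D → D} (hf : Continuous f)
    (hper : ∀ b ∈ branchPoints D, IsPeriodic f b) : Function.Surjective f := by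
  have h : branchPoints D ⊆ range f := fun b hb => by
    obtain ⟨n, hn, h⟩ := hper b hb
    obtain ⟨n, rfl⟩ := Nat.exists_eq_add_of_le' hn
    rw [Function.iterate_succ_apply'] at h
    exact ⟨_, h⟩
  rw [← range_eq_univ, ← (isCompact_range hf).isClosed.closure_eq]
  exact (dense_branchPoints.mono h).closure_eq

/-- If segments between periodic branch points meet every open set along each arithmetic
progression, they meet it under all large iterates. -/
lemma exists_forall_ge_meets {f : D → D} (hf : Continuous f)
    (hper : ∀ b ∈ branchPoints D, IsPeriodic f b)
    (hmeet : ∀ a ∈ branchPoints D, ∀ b ∈ branchPoints D, a ≠ b → ∀ V : Set D, IsOpen V →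
      V.Nonempty → ∀ p : ℕ, 1 ≤ p → ∃ x ∈ seg a b, ∃ k, f^[p * k] x ∈ V)
    {a b : D} (ha : a ∈ branchPoints D) (hb : b ∈ branchPoints D) (hab : a ≠ b)
    {V : Set D} (hV : IsOpen V) (hne : V.Nonempty) :
    ∃ N, ∀ m ≥ N, ∃ x ∈ seg a b, f^[m] x ∈ V := by
  obtain ⟨i, hi, hia⟩ := hper a ha
  obtain ⟨j, hj, hjb⟩ := hper b hb
  have hp : 1 ≤ i * j := Nat.mul_pos hi hj
  have hpa : f^[i * j] a = a := Function.IsPeriodicPt.mul_const (f := f) hia j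
  have hpb : f^[i * j] b = b := Function.IsPeriodicPt.const_mul (f := f) hjb i
  generalize i * j = p at hp hpa hpb
  have hstep : seg a b ⊆ f^[p] '' seg a b :=
    seg_subset ((isPreconnected_seg a b).image _ (hf.iterate p).continuousOn)
      ⟨a, left_mem_seg a b, hpa⟩ ⟨b, right_mem_seg a b, hpb⟩
  have hup : ∀ k l, k ≤ l → ∀ x ∈ seg a b, ∃ y ∈ seg a b, f^[p * l] y = f^[p * k] x := by
    intro k l hkl x hx
    induction l, hkl using Nat.le_induction with
    | base => exact ⟨x, hx, rfl⟩
    | succ l _ ih =>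
      obtain ⟨y, hy, h⟩ := ih
      obtain ⟨z, hz, rfl⟩ := hstep hy
      exact ⟨z, hz, by rw [mul_add_one, Function.iterate_add_apply, h]⟩
  have hr : ∀ r, ∃ k, ∃ x ∈ seg a b, f^[p * k] x ∈ f^[r] ⁻¹' V := fun r => by
    obtain ⟨x, hx, k, hk⟩ := hmeet a ha b hb hab _ (hV.preimage (hf.iterate r))
      (hne.preimage ((surjective_of_periodic hf hper).iterate r)) p hp
    exact ⟨k, x, hx, hk⟩
  choose k x hx hk using hr
  refine ⟨p * (Finset.range p).sup k, fun m hm => ?_⟩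
  have hle : k (m % p) ≤ m / p := (Finset.le_sup (Finset.mem_range.2 (Nat.mod_lt m hp))).trans
    ((Nat.le_div_iff_mul_le hp).2 (by rwa [mul_comm]))
  obtain ⟨y, hy, h⟩ := hup _ _ hle _ (hx (m % p))
  refine ⟨y, hy, ?_⟩
  rw [← Nat.mod_add_div m p, Function.iterate_add_apply, h]
  exact hk (m % p)

lemma topMixing_of_meets {f : D → D}
    (hmeet : ∀ a ∈ branchPoints D, ∀ b ∈ branchPoints D, a ≠ b → ∀ V : Set D, IsOpen V →
      V.Nonempty → ∃ N, ∀ m ≥ N, ∃ x ∈ seg a b, f^[m] x ∈ V) : TopMixing f := by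
  rintro U V hU hV ⟨x, hx⟩ hne
  obtain ⟨y, hy⟩ := exists_ne x
  obtain ⟨b, hb, c, hc, hbc, h⟩ := exists_seg_subset (mem_univ x)
    (fun _ _ _ _ _ _ => mem_univ _) (mem_univ y) hy.symm hU hx
  obtain ⟨N, hN⟩ := hmeet b hb c hc hbc V hV hne
  refine ⟨N, fun n hn => ?_⟩
  obtain ⟨z, hz, hzV⟩ := hN n hn
  exact ⟨_, ⟨z, (h hz).2, rfl⟩, hzV⟩

lemma exists_hasDenseOrbit_mem_seg {f : D → D} (hf : Continuous f)
    (hmeet : ∀ a ∈ branchPoints D, ∀ b ∈ branchPoints D, a ≠ b → ∀ V : Set D, IsOpen V →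
      V.Nonempty → ∃ N, ∀ m ≥ N, ∃ x ∈ seg a b, f^[m] x ∈ V) {a b : D} (hab : a ≠ b) :
    ∃ x ∈ seg a b, HasDenseOrbit f x ∧ ¬ IsEndpointOf D x := by
  have := isCompact_iff_compactSpace.1 (isClosed_seg a b).isCompact
  have hC : Countable (countableBasis D) := (countable_countableBasis D).to_subtype
  let W : countableBasis D → Set (seg a b) := fun V => {x | ∃ n, 1 ≤ n ∧ f^[n] x ∈ (V : Set D)}
  have hWo : ∀ V, IsOpen (W V) := fun V => by
    have : W V = ⋃ n, ⋃ (_ : 1 ≤ n), (fun x : seg a b => f^[n] x) ⁻¹' V := by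
      ext x; simp [W]
    rw [this]
    exact isOpen_iUnion fun n => isOpen_iUnion fun _ =>
      (isOpen_of_mem_countableBasis V.2).preimage ((hf.iterate n).comp continuous_subtype_val)
  have hcv : Convex (seg a b) := fun x hx y hy =>
    seg_subset (isPreconnected_seg a b) hx hy
  have hWd : ∀ V, Dense (W V) := fun V => dense_iff_inter_open.2 <| by
    rintro _ ⟨O, hO, rfl⟩ ⟨x, hx⟩
    obtain ⟨y, hy, hxy⟩ : ∃ y ∈ seg a b, (x : D) ≠ y := by
      by_cases h : (x : D) = a
      · exact ⟨b, right_mem_seg a b, fun hb => hab (h.symm.trans hb)⟩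
      · exact ⟨a, left_mem_seg a b, h⟩
    obtain ⟨c, hc, d, hd, hcd, h⟩ := exists_seg_subset x.2 hcv hy hxy hO hx
    obtain ⟨N, hN⟩ := hmeet c hc d hd hcd V (isOpen_of_mem_countableBasis V.2)
      (nonempty_of_mem_countableBasis V.2)
    obtain ⟨z, hz, hzV⟩ := hN (N + 1) (by omega)
    exact ⟨⟨z, (h hz).1⟩, (h hz).2, N + 1, by omega, hzV⟩
  obtain ⟨c, -, hc, -, hca, hcb⟩ := exists_branchPoint_seg hab finite_empty
  obtain ⟨x, ⟨hxa, hxb⟩, hx⟩ := (dense_iInter_of_isOpen hWo hWd).inter_open_nonempty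
    {x | (x : D) ≠ a ∧ (x : D) ≠ b}
    ((isOpen_ne.preimage continuous_subtype_val).inter (isOpen_ne.preimage continuous_subtype_val))
    ⟨⟨c, hc⟩, hca, hcb⟩
  refine ⟨x, x.2, (isBasis_countableBasis D).dense_iff.2 fun V hV _ => ?_,
    fun h => not_mem_seg_of_isEndpoint h hxa.symm hxb.symm x.2⟩
  obtain ⟨n, hn, h⟩ := mem_iInter.1 hx ⟨V, hV⟩
  exact ⟨_, h, n, hn, rfl⟩

lemma seg_subset_of_isArcEnds {A : Set D} {a b : D} (h : IsArcEnds A a b) : seg a b ⊆ A := by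
  obtain ⟨e, rfl, rfl⟩ := h
  have hpre : IsPreconnected A := by
    have := isPreconnected_range (continuous_subtype_val.comp e.continuous)
    rwa [range_comp, e.surjective.range_eq, image_univ, Subtype.range_coe] at this
  exact seg_subset hpre (e _).2 (e _).2

end Limit

end FineDendrite

/-- On a dendrite with dense endpoints all of whose branch points have
order exactly `n ≥ 3`, there is a mixing map for which every branch point is periodic
and every nondegenerate arc contains a non-endpoint with dense orbit. -/
theorem stmt13 {D : Type*} [MetricSpace D] [CompactSpace D] [ConnectedSpace D]
    (hD : IsDendrite D) {n : ℕ} (hn : 3 ≤ n)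
    (hdense : Dense {p : D | IsEndpointOf D p})
    (horder : ∀ p : D, (componentsAt D p).Finite ∧
      ((componentsAt D p).ncard ≤ 2 ∨ (componentsAt D p).ncard = n)) :
    ∃ f : D → D, Continuous f ∧ TopMixing f ∧
      (∀ p : D, 3 ≤ (componentsAt D p).ncard ∨ (componentsAt D p).Infinite →
        IsPeriodic f p) ∧
      ∀ (A : Set D) (a b : D), a ≠ b → IsArcEnds A a b →
        ∃ x ∈ A, HasDenseOrbit f x ∧ ¬ IsEndpointOf D x := by
  have : Nontrivial D := hD.1
  have : FineDendrite.IsFine D := ⟨hD.2, fun p => (horder p).1, hdense⟩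
  obtain ⟨f, hf, hper, hmeet⟩ := FineDendrite.exists_map_meets D
  have hmeet' : ∀ a ∈ FineDendrite.branchPoints D, ∀ b ∈ FineDendrite.branchPoints D, a ≠ b →
      ∀ V : Set D, IsOpen V → V.Nonempty →
        ∃ N, ∀ m ≥ N, ∃ x ∈ FineDendrite.seg a b, f^[m] x ∈ V :=
    fun a ha b hb hab V hV hne =>
      FineDendrite.exists_forall_ge_meets hf hper hmeet ha hb hab hV hne
  refine ⟨f, hf, FineDendrite.topMixing_of_meets hmeet',
    fun p hp => hper p (hp.resolve_right fun h => h (horder p).1), fun A a b hab hA => ?_⟩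
  obtain ⟨x, hx, h⟩ := FineDendrite.exists_hasDenseOrbit_mem_seg hf hmeet' hab
  exact ⟨x, FineDendrite.seg_subset_of_isArcEnds hA hx, h⟩
end

section
/- Let X be a topological graph (a continuum which can be written as the union of finitely many arcs, any two of which are either disjoint or intersect only in one or both of their endpoints) and f : X → X a continuous map. If the set Per(2^f) of periodic points of the induced map 2^f is dense in the hyperspace 2^X, then Per(f) is dense in X. -/
open Set Topology Filter TopologicalSpace

lemma pos_of_ne_zero_on_Icc {d : ℝ → ℝ} (hd : Continuous d) {a b : ℝ}
    (hne : ∀ t ∈ Icc a b, d t ≠ 0) (ha : 0 < d a) {t : ℝ} (ht : t ∈ Icc a b) : 0 < d t := by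
  by_contra! h
  obtain ⟨s, hs, hs0⟩ := intermediate_value_Icc' ht.1 hd.continuousOn ⟨h, ha.le⟩
  exact hne s ⟨hs.1, hs.2.trans ht.2⟩ hs0

/-- If a lift of a circle map sends the endpoints of two disjoint intervals back into these
intervals modulo `1`, then it has a fixed point or a point of period two modulo `1`. -/
lemma exists_two_cycle_mod_one {φ : ℝ → ℝ} (hφ : Continuous φ) {x₁ y₁ x₂ y₂ u₁ v₁ u₂ v₂ : ℝ}
    (h0 : 0 < x₁) (hy : y₁ < x₂) (h1 : y₂ < 1)
    (hu₁ : u₁ ∈ Icc x₁ y₁) (hv₁ : v₁ ∈ Icc x₁ y₁) (hu₂ : u₂ ∈ Icc x₂ y₂) (hv₂ : v₂ ∈ Icc x₂ y₂)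
    (hx₁ : ∃ m : ℤ, φ x₁ = u₁ + m) (hy₁ : ∃ m : ℤ, φ y₁ = v₁ + m)
    (hx₂ : ∃ m : ℤ, φ x₂ = u₂ + m) (hy₂ : ∃ m : ℤ, φ y₂ = v₂ + m) :
    ∃ z ∈ Icc x₁ y₂, ∃ w ∈ Ioo (0 : ℝ) 1,
      (∃ m : ℤ, φ z = w + m) ∧ ∃ m : ℤ, φ w = z + m := by
  by_cases hD : ∃ t ∈ Icc x₁ y₂, ∃ m : ℤ, φ t = t + m
  · obtain ⟨t, ht, hm⟩ := hD
    exact ⟨t, ht, t, ⟨h0.trans_le ht.1, ht.2.trans_lt h1⟩, hm, hm⟩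
  push Not at hD
  obtain ⟨hu₁l, hu₁r⟩ := hu₁
  obtain ⟨hv₁l, hv₁r⟩ := hv₁
  obtain ⟨hu₂l, hu₂r⟩ := hu₂
  obtain ⟨hv₂l, hv₂r⟩ := hv₂
  obtain ⟨m, hm⟩ := hx₁
  obtain ⟨k₁, hk₁⟩ := hy₁
  obtain ⟨l, hl⟩ := hx₂
  obtain ⟨k₂, hk₂⟩ := hy₂
  have hxne : φ x₁ ≠ x₁ + m := hD x₁ ⟨le_rfl, by linarith⟩ m
  have hlow : ∀ t ∈ Icc x₁ y₂, 0 < φ t - t - m := fun t ht =>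
    pos_of_ne_zero_on_Icc (d := fun t => φ t - t - m) (by fun_prop)
      (fun s hs h => hD s hs m (by linarith))
      (by
        have : x₁ ≠ u₁ := fun h => hxne (by rw [hm, ← h])
        have := lt_of_le_of_ne hu₁l this
        show 0 < φ x₁ - x₁ - m
        linarith) ht
  have hupp : ∀ t ∈ Icc x₁ y₂, 0 < t + 1 + m - φ t := fun t ht =>
    pos_of_ne_zero_on_Icc (d := fun t => t + 1 + m - φ t) (by fun_prop)
      (fun s hs h => hD s hs (m + 1) (by push_cast; linarith))
      (by show 0 < x₁ + 1 + m - φ x₁; linarith) ht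
  have hk₁' : m + 1 ≤ k₁ := by
    have := hlow y₁ ⟨by linarith, by linarith⟩
    have : (m : ℝ) < k₁ := by linarith
    exact_mod_cast this
  have hl' : l = m := by
    have h₁ := hlow x₂ ⟨by linarith, by linarith⟩
    have h₂ := hupp x₂ ⟨by linarith, by linarith⟩
    have h₃ : (l : ℝ) < m + 1 := by linarith
    have h₄ : (m : ℝ) < l + 1 := by linarith
    norm_cast at h₃ h₄
    omega
  have hk₂' : k₂ = m + 1 := by
    have h₁ := hlow y₂ ⟨by linarith, by linarith⟩
    have h₂ := hupp y₂ ⟨by linarith, by linarith⟩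
    have h₃ : (m : ℝ) < k₂ := by linarith
    have h₄ : (k₂ : ℝ) < m + 2 := by linarith
    norm_cast at h₃ h₄
    omega
  have hk₁r : (m : ℝ) + 1 ≤ k₁ := by exact_mod_cast hk₁'
  subst hl' hk₂'
  push_cast at hk₂
  obtain ⟨z, hz, hz0⟩ : ∃ z ∈ Icc x₁ y₁,
      φ (max x₂ (min y₂ (φ z - l))) - z - 1 - l = 0 := by
    apply intermediate_value_Icc (f := fun z => φ (max x₂ (min y₂ (φ z - l))) - z - 1 - l)
      (by linarith) (by fun_prop)
    constructor
    · have : max x₂ (min y₂ (φ x₁ - l)) = x₂ :=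
        max_eq_left ((min_le_right _ _).trans (by linarith))
      simp only [this]
      linarith
    · have : max x₂ (min y₂ (φ y₁ - l)) = y₂ := by
        rw [min_eq_left (by linarith), max_eq_right (by linarith)]
      simp only [this]
      linarith
  obtain ⟨hzl, hzr⟩ := hz
  rcases lt_or_ge (φ z - l) x₂ with h | h
  · rw [max_eq_left ((min_le_right _ _).trans h.le)] at hz0
    linarith
  rcases lt_or_ge y₂ (φ z - l) with h' | h'
  · rw [min_eq_left h'.le, max_eq_right (by linarith)] at hz0
    linarith
  rw [min_eq_right h', max_eq_right h] at hz0
  exact ⟨z, ⟨by linarith, by linarith⟩, φ z - l, ⟨by linarith, by linarith⟩, ⟨l, by ring⟩,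
    l + 1, by push_cast; linarith⟩

lemma addCircle_one_coe_eq_coe_iff {s t : ℝ} :
    (s : AddCircle (1 : ℝ)) = t ↔ ∃ m : ℤ, s = t + m := by
  rw [← sub_eq_zero, ← AddCircle.coe_sub, AddCircle.coe_eq_zero_iff]
  constructor
  · rintro ⟨m, hm⟩
    exact ⟨m, by simp at hm; linarith⟩
  · rintro ⟨m, hm⟩
    exact ⟨m, by simp [hm]⟩

/-- Collapsing the complement of an open free arc to a point maps the space to the circle. -/
lemma exists_collapse_to_circle {X : Type*} [TopologicalSpace X] [T2Space X]
    {e : unitInterval → X} (he : Continuous e) (hinj : Function.Injective e)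
    (hopen : IsOpen (e '' Ioo 0 1)) :
    ∃ c : X → AddCircle (1 : ℝ), Continuous c ∧ (∀ t, c (e t) = ((t : ℝ) : AddCircle (1 : ℝ))) ∧
      ∀ z, ∀ t ∈ Ioo (0 : unitInterval) 1, c z = ((t : ℝ) : AddCircle (1 : ℝ)) → z = e t := by
  classical
  have hemb := he.isClosedEmbedding hinj
  let c : X → AddCircle (1 : ℝ) := Function.extend e (fun t => ((t : ℝ) : AddCircle (1 : ℝ)))
    fun _ => 0
  have hce : ∀ t, c (e t) = ((t : ℝ) : AddCircle (1 : ℝ)) := fun t => hinj.extend_apply _ _ t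
  have hout : ∀ z ∈ (e '' Ioo 0 1)ᶜ, c z = 0 := by
    intro z hz
    by_cases h : ∃ t, e t = z
    · obtain ⟨t, rfl⟩ := h
      rw [hce]
      have ht : t ∉ Ioo (0 : unitInterval) 1 := fun ht => hz ⟨t, ht, rfl⟩
      rcases eq_or_ne t 0 with rfl | h0
      · simp
      rcases eq_or_ne t 1 with rfl | h1
      · simp
      exact (ht ⟨unitInterval.pos_iff_ne_zero.2 h0, unitInterval.lt_one_iff_ne_one.2 h1⟩).elim
    · exact Function.extend_apply' _ _ _ h
  refine ⟨c, ?_, hce, ?_⟩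
  · have h₁ : ContinuousOn c (range e) := by
      rw [continuousOn_iff_continuous_domRestrict,
        ← hemb.isEmbedding.toHomeomorph.comp_continuous_iff']
      exact ((AddCircle.continuous_mk' (1 : ℝ)).comp continuous_subtype_val).congr
        fun t => (hce t).symm
    have h₂ : ContinuousOn c (e '' Ioo 0 1)ᶜ := continuousOn_const.congr hout
    have := h₁.union_of_isClosed h₂ hemb.isClosed_range hopen.isClosed_compl
    rw [← continuousOn_univ]
    refine this.mono fun z _ => ?_
    by_cases hz : z ∈ e '' Ioo 0 1
    · exact Or.inl (image_subset_range _ _ hz)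
    · exact Or.inr hz
  · intro z t ht hz
    by_cases h : z ∈ e '' Ioo 0 1
    · obtain ⟨s, hs, rfl⟩ := h
      rw [hce, AddCircle.coe_eq_coe_iff_of_mem_Ico (a := 0)
        ⟨s.2.1, by simpa using (show (s : ℝ) < 1 from hs.2)⟩
        ⟨t.2.1, by simpa using (show (t : ℝ) < 1 from ht.2)⟩] at hz
      rw [Subtype.ext hz]
    · rw [hout z h, eq_comm, AddCircle.coe_eq_zero_iff_of_mem_Ico
        ⟨t.2.1, (show (t : ℝ) < 1 from ht.2)⟩] at hz
      exact absurd hz (ne_of_gt ht.1)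

lemma coe_hyperMap_iterate {X : Type*} [TopologicalSpace X] {f : X → X} (hf : Continuous f)
    (B : NonemptyCompacts X) (n : ℕ) :
    (((hyperMap hf)^[n] B : NonemptyCompacts X) : Set X) = f^[n] '' (B : Set X) := by
  induction n with
  | zero => simp
  | succ n ih =>
    rw [Function.iterate_succ_apply', Function.iterate_succ', image_comp, ← ih]
    rfl

/-- A compact set invariant under `g` and contained in an arc has a first and a last point, and
these are mapped by `g` between them. -/
lemma exists_extreme_points {X : Type*} [TopologicalSpace X] [T2Space X]
    {e : unitInterval → X} (he : Continuous e) (hinj : Function.Injective e) {g : X → X}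
    {B : Set X} (hB : IsCompact B) (hne : B.Nonempty) (hg : g '' B = B) {p q : unitInterval}
    (hsub : B ⊆ e '' Ioo p q) :
    ∃ x y u v : unitInterval, p < x ∧ y < q ∧ u ∈ Icc x y ∧ v ∈ Icc x y ∧
      g (e x) = e u ∧ g (e y) = e v := by
  have hS : IsCompact (e ⁻¹' B) := (hB.isClosed.preimage he).isCompact
  have hlift : ∀ z ∈ B, ∃ t ∈ Ioo p q, e t = z := hsub
  have hSne : (e ⁻¹' B).Nonempty := by
    obtain ⟨z, hz⟩ := hne
    obtain ⟨t, -, rfl⟩ := hlift z hz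
    exact ⟨t, hz⟩
  have hSg : ∀ t ∈ e ⁻¹' B, ∃ u ∈ e ⁻¹' B, g (e t) = e u := by
    intro t ht
    have hgt : g (e t) ∈ B := hg ▸ mem_image_of_mem g ht
    obtain ⟨u, -, hu⟩ := hlift _ hgt
    exact ⟨u, by rwa [mem_preimage, hu], hu.symm⟩
  obtain ⟨x, hx⟩ := hS.exists_isLeast hSne
  obtain ⟨y, hy⟩ := hS.exists_isGreatest hSne
  obtain ⟨u, hu, hxu⟩ := hSg x hx.1
  obtain ⟨v, hv, hyv⟩ := hSg y hy.1
  obtain ⟨x', hx', hxx'⟩ := hlift _ hx.1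
  obtain ⟨y', hy', hyy'⟩ := hlift _ hy.1
  obtain rfl := hinj hxx'
  obtain rfl := hinj hyy'
  exact ⟨x', y', u, v, hx'.1, hy'.2, ⟨hx.2 hu, hy.2 hu⟩, ⟨hx.2 hv, hy.2 hv⟩, hxu, hyv⟩

lemma isPeriodic_of_two_cycle {X : Type*} {f : X → X} {n : ℕ} (hn : 1 ≤ n) {z w : X}
    (hz : f^[n] z = w) (hw : f^[n] w = z) : IsPeriodic f z :=
  ⟨n + n, by omega, by rw [Function.iterate_add_apply, hz, hw]⟩

lemma exists_periodic_hyperMap_subset {X : Type*} [TopologicalSpace X] {f : X → X}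
    (hf : Continuous f) (hper : Dense {B : NonemptyCompacts X | IsPeriodic (hyperMap hf) B})
    {U : Set X} (hU : IsOpen U) (hne : U.Nonempty) :
    ∃ B : NonemptyCompacts X, (B : Set X) ⊆ U ∧ IsPeriodic (hyperMap hf) B := by
  obtain ⟨x, hx⟩ := hne
  obtain ⟨B, hBU, hB⟩ := hper.inter_open_nonempty _
    (NonemptyCompacts.isOpen_subsets_of_isOpen hU) ⟨{x}, by simpa using hx⟩
  exact ⟨B, hBU, hB⟩

/-- Every subarc of an open free arc contains a periodic point of `f` as soon as the
periodic points of the induced hyperspace map are dense. -/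
lemma exists_isPeriodic_of_open_arc {X : Type*} [TopologicalSpace X] [T2Space X] {f : X → X}
    (hf : Continuous f) (hper : Dense {B : NonemptyCompacts X | IsPeriodic (hyperMap hf) B})
    {e : unitInterval → X} (he : Continuous e) (hinj : Function.Injective e)
    (hopen : ∀ W ⊆ Ioo (0 : unitInterval) 1, IsOpen W → IsOpen (e '' W))
    {p q : unitInterval} (hpq : p < q) : ∃ t ∈ Ioo p q, IsPeriodic f (e t) := by
  obtain ⟨c, hc, hce, hcinj⟩ :=
    exists_collapse_to_circle he hinj (hopen _ Subset.rfl isOpen_Ioo)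
  obtain ⟨r, hpr, hrq⟩ := exists_between hpq
  obtain ⟨B₁, hB₁, n₁, hn₁, hp₁⟩ := exists_periodic_hyperMap_subset hf hper
    (hopen (Ioo p r) (Ioo_subset_Ioo bot_le le_top) isOpen_Ioo) ((nonempty_Ioo.2 hpr).image e)
  obtain ⟨B₂, hB₂, n₂, hn₂, hp₂⟩ := exists_periodic_hyperMap_subset hf hper
    (hopen (Ioo r q) (Ioo_subset_Ioo bot_le le_top) isOpen_Ioo) ((nonempty_Ioo.2 hrq).image e)
  have hn : 1 ≤ n₁ * n₂ := Nat.mul_pos hn₁ hn₂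
  set n := n₁ * n₂ with hndef
  have hi₁ : f^[n] '' (B₁ : Set X) = B₁ := by
    rw [← coe_hyperMap_iterate hf,
      (Function.IsPeriodicPt.mul_const (show Function.IsPeriodicPt _ n₁ B₁ from hp₁) n₂).eq]
  have hi₂ : f^[n] '' (B₂ : Set X) = B₂ := by
    rw [← coe_hyperMap_iterate hf,
      (Function.IsPeriodicPt.const_mul (show Function.IsPeriodicPt _ n₂ B₂ from hp₂) n₁).eq]
  obtain ⟨x₁, y₁, u₁, v₁, hx₁, hy₁, hu₁, hv₁, hxu₁, hyv₁⟩ :=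
    exists_extreme_points he hinj B₁.isCompact B₁.nonempty hi₁ hB₁
  obtain ⟨x₂, y₂, u₂, v₂, hx₂, hy₂, hu₂, hv₂, hxu₂, hyv₂⟩ :=
    exists_extreme_points he hinj B₂.isCompact B₂.nonempty hi₂ hB₂
  let γ : C(unitInterval, AddCircle (1 : ℝ)) :=
    ⟨fun t => c (f^[n] (e t)), hc.comp ((hf.iterate n).comp he)⟩
  obtain ⟨s, hs⟩ := QuotientAddGroup.mk_surjective (γ 0)
  obtain ⟨Γ, hΓ, -⟩ := (AddCircle.isCoveringMap_coe (1 : ℝ)).exists_path_lifts γ s hs.symm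
  have hlift : ∀ t, ((Γ t : ℝ) : AddCircle (1 : ℝ)) = c (f^[n] (e t)) := fun t => congrFun hΓ t
  let φ : ℝ → ℝ := IccExtend zero_le_one Γ
  have hφ : Continuous φ := Γ.continuous.Icc_extend'
  have hφΓ : ∀ t : unitInterval, φ t = Γ t := fun t => IccExtend_val _ _ t
  have hmod : ∀ t w : unitInterval, f^[n] (e t) = e w → ∃ m : ℤ, φ t = w + m := by
    intro t w h
    rw [hφΓ, ← addCircle_one_coe_eq_coe_iff, hlift, h, hce]
  have hback : ∀ t : unitInterval, ∀ w ∈ Ioo (0 : unitInterval) 1, (∃ m : ℤ, φ t = w + m) →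
      f^[n] (e t) = e w := by
    intro t w hw h
    rw [hφΓ, ← addCircle_one_coe_eq_coe_iff, hlift] at h
    exact hcinj _ _ hw h
  obtain ⟨z, hz, w, hw, hzw, hwz⟩ := exists_two_cycle_mod_one hφ
    (p.2.1.trans_lt (Subtype.coe_lt_coe.2 hx₁)) (Subtype.coe_lt_coe.2 (hy₁.trans hx₂))
    ((Subtype.coe_lt_coe.2 hy₂).trans_le q.2.2)
    hu₁ hv₁ hu₂ hv₂ (hmod _ _ hxu₁) (hmod _ _ hyv₁) (hmod _ _ hxu₂) (hmod _ _ hyv₂)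
  lift z to unitInterval using ⟨x₁.2.1.trans hz.1, hz.2.trans y₂.2.2⟩
  lift w to unitInterval using Ioo_subset_Icc_self hw
  have hzpq : z ∈ Ioo p q :=
    ⟨hx₁.trans_le (Subtype.coe_le_coe.1 hz.1), (Subtype.coe_le_coe.1 hz.2).trans_lt hy₂⟩
  exact ⟨z, hzpq, isPeriodic_of_two_cycle hn (hback z w hw hzw)
    (hback w z (Ioo_subset_Ioo bot_le le_top hzpq) hwz)⟩

lemma isOpen_image_of_free {X : Type*} [TopologicalSpace X] {A : Set X}
    (E : unitInterval ≃ₜ A) (hfree : IsOpen (A \ {(E 0 : X), (E 1 : X)}))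
    {W : Set unitInterval} (hW : IsOpen W) (hsub : W ⊆ Ioo 0 1) :
    IsOpen ((fun t => (E t : X)) '' W) := by
  obtain ⟨O, hO, hOW⟩ := isOpen_induced_iff.1 (E.isOpenMap W hW)
  convert hO.inter hfree using 1
  ext z
  constructor
  · rintro ⟨t, ht, rfl⟩
    refine ⟨?_, (E t).2, ?_⟩
    · have : E t ∈ Subtype.val ⁻¹' O := hOW ▸ mem_image_of_mem E ht
      exact this
    · rintro (h | h)
      · exact (hsub ht).1.ne' (E.injective (Subtype.ext h))
      · exact (hsub ht).2.ne (E.injective (Subtype.ext h))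
  · rintro ⟨hzO, hzA, -⟩
    have : (⟨z, hzA⟩ : A) ∈ E '' W := hOW ▸ hzO
    obtain ⟨t, ht, htz⟩ := this
    exact ⟨t, ht, congrArg Subtype.val htz⟩

/-- In a union of finitely many closed sets, a member meeting the others only inside a finite
set `F` is open outside `F`. -/
lemma isOpen_diff_of_inter_subset {X : Type*} [TopologicalSpace X] [T1Space X] {ι : Type*}
    [Finite ι] {A : ι → Set X} (hA : ∀ i, IsClosed (A i)) (hcover : (⋃ i, A i) = univ) (i : ι)
    {F : Set X} (hF : F.Finite) (hmeet : ∀ j, i ≠ j → A i ∩ A j ⊆ F) : IsOpen (A i \ F) := by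
  have hcl : IsClosed ((⋃ j ∈ {j | i ≠ j}, A j) ∪ F) :=
    ((toFinite _).isClosed_biUnion fun j _ => hA j).union hF.isClosed
  convert hcl.isOpen_compl using 1
  ext z
  simp only [Set.mem_sdiff, mem_compl_iff, mem_union, mem_iUnion, not_or, not_exists]
  constructor
  · rintro ⟨hz, hzF⟩
    exact ⟨fun j hj hzj => hzF (hmeet j hj ⟨hz, hzj⟩), hzF⟩
  · rintro ⟨hz, hzF⟩
    obtain ⟨j, hj⟩ := mem_iUnion.1 (hcover ▸ mem_univ z : z ∈ ⋃ i, A i)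
    refine ⟨?_, hzF⟩
    by_cases h : i = j
    · exact h ▸ hj
    · exact (hz j h hj).elim

/-- On a topological graph, density of the periodic points of the induced
hyperspace map implies density of the periodic points of `f`. -/
theorem stmt16 {X : Type*} [MetricSpace X] [CompactSpace X] [ConnectedSpace X]
    {k : ℕ} (A : Fin k → Set X) (a b : Fin k → X)
    (harc : ∀ i, IsArcEnds (A i) (a i) (b i))
    (hcover : (⋃ i, A i) = Set.univ)
    (hmeet : ∀ i j, i ≠ j → A i ∩ A j ⊆ ({a i, b i} ∩ {a j, b j} : Set X))
    {f : X → X} (hf : Continuous f)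
    (hper : Dense {B : NonemptyCompacts X | IsPeriodic (hyperMap hf) B}) :
    Dense {p : X | IsPeriodic f p} := by
  rw [dense_iff_inter_open]
  rintro V hV ⟨x, hx⟩
  obtain ⟨i, hi⟩ := mem_iUnion.1 (hcover ▸ mem_univ x : x ∈ ⋃ i, A i)
  have hclosed : ∀ j, IsClosed (A j) := by
    intro j
    obtain ⟨E, -⟩ := harc j
    exact (isCompact_iff_compactSpace.2 E.compactSpace).isClosed
  obtain ⟨E, hEa, hEb⟩ := harc i
  have hfree : IsOpen (A i \ {a i, b i}) :=
    isOpen_diff_of_inter_subset hclosed hcover i (by simp)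
      fun j hij => (hmeet i j hij).trans inter_subset_left
  rw [← hEa, ← hEb] at hfree
  have hE : Continuous fun t => (E t : X) := continuous_subtype_val.comp E.continuous
  obtain ⟨p, q, hpq, hsub⟩ := (hV.preimage hE).exists_Ioo_subset
    ⟨E.symm ⟨x, hi⟩, by simpa using hx⟩
  obtain ⟨t, htpq, ht⟩ := exists_isPeriodic_of_open_arc hf hper hE
    (Subtype.val_injective.comp E.injective)
    (fun W hW hWo => isOpen_image_of_free E hfree hWo hW) hpq
  exact ⟨_, hsub htpq, ht⟩
end

section
/- Let X be a dendrite whose set of endpoints End(X) is either countable or closed in X, and let f : X → X be a continuous map. If the set Per(2^f) of periodic points of the induced map 2^f is dense in the hyperspace 2^X, then Per(f) is dense in X. -/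
open Set Topology Filter TopologicalSpace

namespace Dendrite

/-- The component of `x` in the complement of `t`. -/
def comp {X : Type*} [TopologicalSpace X] (t x : X) : Set X :=
  connectedComponentIn ({t}ᶜ : Set X) x

/-- The points lying in every connected set which contains `a` and `b`. -/
def seg {X : Type*} [TopologicalSpace X] (a b : X) : Set X :=
  {t | ∀ Z : Set X, IsPreconnected Z → a ∈ Z → b ∈ Z → t ∈ Z}

section Basic

variable {X : Type*} [TopologicalSpace X]

lemma mem_comp_self {t x : X} (h : x ≠ t) : x ∈ comp t x :=
  mem_connectedComponentIn h

lemma isPreconnected_comp (t x : X) : IsPreconnected (comp t x) :=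
  isPreconnected_connectedComponentIn

lemma notMem_comp (t x : X) : t ∉ comp t x := fun h =>
  connectedComponentIn_subset _ _ h rfl

lemma subset_comp {t x : X} {Z : Set X} (hZ : IsPreconnected Z) (hx : x ∈ Z) (ht : t ∉ Z) :
    Z ⊆ comp t x :=
  hZ.subset_connectedComponentIn hx fun _ hz hzt => ht (hzt ▸ hz)

lemma comp_eq {t x y : X} (h : y ∈ comp t x) : comp t x = comp t y :=
  connectedComponentIn_eq h

lemma comp_self (x : X) : comp x x = ∅ := by
  simp [comp, connectedComponentIn_eq_empty]

lemma mem_insert_comp_self (t x : X) : x ∈ insert t (comp t x) := by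
  by_cases h : x = t
  · exact Or.inl h
  · exact Or.inr (mem_comp_self h)

lemma isClosed_insert_comp [T1Space X] (t x : X) : IsClosed (insert t (comp t x)) := by
  refine isClosed_of_closure_subset fun z hz => ?_
  by_cases h : z = t
  · exact Or.inl h
  right
  have hx : x ∈ comp t x := by
    by_contra hx
    have hxt : x = t := by
      by_contra hne
      exact hx (mem_comp_self hne)
    subst hxt
    rw [comp_self, insert_empty_eq, closure_singleton] at hz
    exact h hz
  have hz' : z ∈ closure (comp t x) := by
    rw [← singleton_union, closure_union, closure_singleton] at hz
    exact hz.resolve_left h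
  refine subset_comp ((isPreconnected_comp t x).subset_closure (subset_insert z _)
    (insert_subset hz' subset_closure)) (mem_insert_of_mem _ hx) ?_ (mem_insert _ _)
  rintro (h' | h')
  exacts [h h'.symm, notMem_comp _ _ h']

lemma mem_seg_iff {a b t : X} : t ∈ seg a b ↔ b ∉ comp t a := by
  constructor
  · intro h hb
    have hat : a ≠ t := by
      rintro rfl
      simp [comp_self] at hb
    exact notMem_comp t a (h _ (isPreconnected_comp t a) (mem_comp_self hat) hb)
  · intro h Z hZ ha hb
    by_contra ht
    exact h (subset_comp hZ ha ht hb)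

lemma mem_comp_iff {a b t : X} : b ∈ comp t a ↔ t ∉ seg a b := by
  rw [mem_seg_iff, not_not]

lemma seg_comm (a b : X) : seg a b = seg b a := by
  ext t
  exact ⟨fun h Z hZ ha hb => h Z hZ hb ha, fun h Z hZ ha hb => h Z hZ hb ha⟩

lemma left_mem_seg (a b : X) : a ∈ seg a b := fun _ _ ha _ => ha

lemma right_mem_seg (a b : X) : b ∈ seg a b := fun _ _ _ hb => hb

lemma seg_subset {a b u v : X} (hu : u ∈ seg a b) (hv : v ∈ seg a b) : seg u v ⊆ seg a b :=
  fun _ ht Z hZ ha hb => ht Z hZ (hu Z hZ ha hb) (hv Z hZ ha hb)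

lemma seg_subset_union (a b c : X) : seg a c ⊆ seg a b ∪ seg b c := by
  intro t ht
  by_contra h
  simp only [mem_union, not_or, seg, mem_ofPred_eq, not_forall] at h
  obtain ⟨⟨Z, hZ, ha, hb, hz⟩, Z', hZ', hb', hc, hz'⟩ := h
  rcases ht _ (hZ.union b hb hb' hZ') (Or.inl ha) (Or.inr hc) with h | h
  exacts [hz h, hz' h]

lemma disjoint_comp {a b t : X} (ht : t ∈ seg a b) : Disjoint (comp t a) (comp t b) := by
  rw [disjoint_left]
  intro z hza hzb
  have hbt : b ≠ t := by
    rintro rfl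
    simp [comp_self] at hzb
  refine mem_seg_iff.1 ht ?_
  rw [comp_eq hza, ← comp_eq hzb]
  exact mem_comp_self hbt

lemma notMem_comp_of_mem_seg {a b t : X} (ht : t ∈ seg a b) : a ∉ comp t b := fun h =>
  mem_comp_iff.1 h (seg_comm a b ▸ ht)

end Basic

section Bumping

variable {Y : Type*} [TopologicalSpace Y] [CompactSpace Y] [T2Space Y] [PreconnectedSpace Y]

/-- Boundary bumping. -/
lemma closure_connectedComponentIn_inter_nonempty {F : Set Y} (hF : IsClosed F)
    (hne : F.Nonempty) {q : Y} (hq : q ∉ F) :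
    (closure (connectedComponentIn Fᶜ q) ∩ F).Nonempty := by
  by_contra hemp
  rw [not_nonempty_iff_eq_empty] at hemp
  set K := connectedComponentIn Fᶜ q with hK
  have hqK : q ∈ K := mem_connectedComponentIn hq
  have hdisj : Disjoint (closure K) F := disjoint_iff_inter_eq_empty.2 hemp
  obtain ⟨V, W, hV, hW, hKV, hFW, hVW⟩ := normal_separation isClosed_closure hF hdisj
  have hVF : Disjoint (closure V) F :=
    (hVW.closure_left hW).mono_right hFW
  have : CompactSpace (closure V) := isCompact_iff_compactSpace.1 isClosed_closure.isCompact
  have hqV : q ∈ closure V := subset_closure (hKV (subset_closure hqK))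
  let q' : closure V := ⟨q, hqV⟩
  have hcomp : (connectedComponent q' : Set (closure V)) ⊆ (Subtype.val ⁻¹' V) := by
    have h1 : IsPreconnected (Subtype.val '' (connectedComponent q' : Set (closure V))) :=
      isPreconnected_connectedComponent.image _ continuous_subtype_val.continuousOn
    have h2 : Subtype.val '' (connectedComponent q' : Set (closure V)) ⊆ K := by
      refine h1.subset_connectedComponentIn ⟨q', mem_connectedComponent, rfl⟩ ?_
      rintro _ ⟨z, -, rfl⟩ hz
      exact hVF.le_bot ⟨z.2, hz⟩
    intro z hz
    exact hKV (subset_closure (h2 ⟨z, hz, rfl⟩))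
  rw [connectedComponent_eq_iInter_isClopen] at hcomp
  have : Nonempty { s : Set (closure V) // IsClopen s ∧ q' ∈ s } :=
    ⟨⟨univ, isClopen_univ, mem_univ _⟩⟩
  obtain ⟨⟨G, hG, hqG⟩, hGV⟩ := exists_subset_nhds_of_isCompact
    (V := fun s : { s : Set (closure V) // IsClopen s ∧ q' ∈ s } => (s : Set (closure V)))
    (fun s t => ⟨⟨s.1 ∩ t.1, s.2.1.inter t.2.1, s.2.2, t.2.2⟩, inter_subset_left,
      inter_subset_right⟩)
    (fun s => s.2.1.1.isCompact)
    (U := Subtype.val ⁻¹' V)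
    (fun z hz => (hV.preimage continuous_subtype_val).mem_nhds (hcomp hz))
  have hGcl : IsClosed (Subtype.val '' G) :=
    (isClosed_closure.isClosedEmbedding_subtypeVal).isClosedMap _ hG.1
  have hGop : IsOpen (Subtype.val '' G) := by
    obtain ⟨O, hO, hOG⟩ := isOpen_induced_iff.1 hG.2
    have : Subtype.val '' G = O ∩ V := by
      ext z
      constructor
      · rintro ⟨w, hw, rfl⟩
        exact ⟨by rw [← hOG] at hw; exact hw, hGV hw⟩
      · rintro ⟨h1, h2⟩
        exact ⟨⟨z, subset_closure h2⟩, by rw [← hOG]; exact h1, rfl⟩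
    rw [this]
    exact hO.inter hV
  have huniv : Subtype.val '' G = univ := IsClopen.eq_univ ⟨hGcl, hGop⟩ ⟨q, q', hqG, rfl⟩
  obtain ⟨f, hf⟩ := hne
  obtain ⟨z, -, hz⟩ : f ∈ Subtype.val '' G := huniv ▸ mem_univ f
  exact hVF.le_bot ⟨z.2, hz ▸ hf⟩

end Bumping

section Continuum

variable {X : Type*} [TopologicalSpace X] [CompactSpace X] [T2Space X]

lemma exists_preconnected_bump {Z F : Set X} (hZc : IsClosed Z) (hZ : IsPreconnected Z)
    (hF : IsClosed F) {q : X} (hqZ : q ∈ Z) (hq : q ∉ F) (hne : (Z ∩ F).Nonempty) :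
    ∃ O ⊆ Z, IsPreconnected O ∧ q ∈ O ∧ Disjoint O F ∧ (closure O ∩ F).Nonempty := by
  have : CompactSpace Z := isCompact_iff_compactSpace.1 hZc.isCompact
  have : PreconnectedSpace Z := Subtype.preconnectedSpace hZ
  obtain ⟨w, hwZ, hwF⟩ := hne
  have hq' : (⟨q, hqZ⟩ : Z) ∉ (Subtype.val ⁻¹' F : Set Z) := hq
  obtain ⟨m, hm, hmF⟩ := closure_connectedComponentIn_inter_nonempty
    (hF.preimage (continuous_subtype_val : Continuous (Subtype.val : Z → X)))
    ⟨⟨w, hwZ⟩, hwF⟩ hq'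
  refine ⟨Subtype.val '' connectedComponentIn (Subtype.val ⁻¹' F : Set Z)ᶜ ⟨q, hqZ⟩, ?_, ?_, ?_,
    ?_, m, ?_, hmF⟩
  · rintro _ ⟨z, -, rfl⟩
    exact z.2
  · exact isPreconnected_connectedComponentIn.image _ continuous_subtype_val.continuousOn
  · exact ⟨_, mem_connectedComponentIn hq', rfl⟩
  · rw [disjoint_left]
    rintro _ ⟨z, hz, rfl⟩ hzF
    exact connectedComponentIn_subset _ _ hz hzF
  · exact image_closure_subset_closure_image continuous_subtype_val ⟨m, hm, rfl⟩

variable [ConnectedSpace X]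

lemma mem_closure_comp {t x : X} (h : x ≠ t) : t ∈ closure (comp t x) := by
  obtain ⟨m, hm, rfl⟩ := closure_connectedComponentIn_inter_nonempty (isClosed_singleton (x := t))
    (singleton_nonempty t) (q := x) h
  exact hm

lemma isPreconnected_insert_comp (t x : X) : IsPreconnected (insert t (comp t x)) := by
  by_cases h : x = t
  · subst h
    rw [comp_self, insert_empty_eq]
    exact isPreconnected_singleton
  · exact (isPreconnected_comp t x).subset_closure (subset_insert _ _)
      (insert_subset (mem_closure_comp h) subset_closure)

lemma isPreconnected_compl_comp (t x : X) : IsPreconnected (comp t x)ᶜ := by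
  have : (comp t x)ᶜ = ⋃₀ {S | ∃ y ∉ comp t x, S = insert t (comp t y)} := by
    ext z
    constructor
    · intro hz
      exact ⟨_, ⟨z, hz, rfl⟩, mem_insert_comp_self t z⟩
    · rintro ⟨_, ⟨y, hy, rfl⟩, rfl | hz⟩ hz'
      · exact notMem_comp _ _ hz'
      · apply hy
        rw [comp_eq hz', ← comp_eq hz]
        refine mem_comp_self ?_
        rintro rfl
        simp [comp_self] at hz
  rw [this]
  refine isPreconnected_sUnion t _ ?_ ?_
  · rintro _ ⟨y, -, rfl⟩
    exact mem_insert _ _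
  · rintro _ ⟨y, -, rfl⟩
    exact isPreconnected_insert_comp t y

lemma seg_inter_seg {a b t : X} (ht : t ∈ seg a b) {s : X} (h1 : s ∈ seg a t)
    (h2 : s ∈ seg t b) : s = t := by
  by_contra hne
  have h3 := (h1 _ (isPreconnected_insert_comp t a) (mem_insert_comp_self t a)
    (mem_insert _ _)).resolve_left hne
  have h4 := (h2 _ (isPreconnected_insert_comp t b) (mem_insert _ _)
    (mem_insert_comp_self t b)).resolve_left hne
  have hb : b ≠ t := by
    rintro rfl
    simp [comp_self] at h4
  refine mem_seg_iff.1 ht ?_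
  rw [comp_eq h3, ← comp_eq h4]
  exact mem_comp_self hb

lemma seg_antisymm {a b q : X} (h1 : a ∈ seg q b) (h2 : q ∈ seg a b) : a = q :=
  seg_inter_seg h2 (left_mem_seg a q) h1

end Continuum

/-- Any two distinct points are separated by a third one. -/
def Separated (X : Type*) [TopologicalSpace X] : Prop :=
  ∀ x y : X, x ≠ y → ∃ t ∈ seg x y, t ≠ x ∧ t ≠ y

lemma separated_of_isDendrite {X : Type*} [TopologicalSpace X] (h : IsDendrite X) :
    Separated X := by
  intro x y hxy
  obtain ⟨z, hzx, hzy, hne⟩ := h.2 x y hxy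
  exact ⟨z, mem_seg_iff.2 fun hy => hne (comp_eq hy), hzx, hzy⟩

section Topology

variable {X : Type*} [TopologicalSpace X] [CompactSpace X] [T2Space X] [ConnectedSpace X]

lemma Separated.isOpen_comp (H : Separated X) (t x : X) : IsOpen (comp t x) := by
  rw [← isClosed_compl_iff]
  refine isClosed_of_closure_subset fun q hq hqC => ?_
  have hqt : q ≠ t := by
    rintro rfl
    exact notMem_comp _ _ hqC
  obtain ⟨s, hs, hsq, hst⟩ := H q t hqt
  have hsC : s ∈ comp t x := (hs _ (isPreconnected_insert_comp t x)
    (mem_insert_of_mem _ hqC) (mem_insert _ _)).resolve_left hst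
  have hsub : (comp t x)ᶜ ⊆ comp s t :=
    subset_comp (isPreconnected_compl_comp t x) (notMem_comp t x) (fun h => h hsC)
  have hq2 : q ∈ insert s (comp s t) :=
    closure_minimal (hsub.trans (subset_insert _ _)) (isClosed_insert_comp s t) hq
  exact mem_comp_iff.1 (hq2.resolve_left hsq.symm) (seg_comm q t ▸ hs)

lemma Separated.exists_closed_preconnected (H : Separated X) {m a b : X} (h : m ∉ seg a b) :
    ∃ Z, IsClosed Z ∧ IsPreconnected Z ∧ a ∈ Z ∧ b ∈ Z ∧ m ∉ Z := by
  have ham : a ≠ m := fun e => h (e ▸ left_mem_seg a b)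
  refine (isPreconnected_comp m a).induction₂'
    (fun a b => ∃ Z, IsClosed Z ∧ IsPreconnected Z ∧ a ∈ Z ∧ b ∈ Z ∧ m ∉ Z) ?_ ?_
    (mem_comp_self ham) (mem_comp_iff.2 h)
  · intro x hx
    have hxm : x ≠ m := fun e => notMem_comp m a (e ▸ hx)
    obtain ⟨u, hu, hux, hum⟩ := H x m hxm
    have hmem : comp u x ∈ 𝓝 x := (H.isOpen_comp u x).mem_nhds (mem_comp_self hux.symm)
    have hm : m ∉ insert u (comp u x) := by
      rintro (h | h)
      exacts [hum h.symm, mem_seg_iff.1 hu h]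
    filter_upwards [mem_nhdsWithin_of_mem_nhds hmem] with y hy
    exact ⟨⟨_, isClosed_insert_comp u x, isPreconnected_insert_comp u x,
      mem_insert_comp_self u x, mem_insert_of_mem _ hy, hm⟩,
      ⟨_, isClosed_insert_comp u x, isPreconnected_insert_comp u x,
      mem_insert_of_mem _ hy, mem_insert_comp_self u x, hm⟩⟩
  · rintro x y z - - - ⟨Z, hZ1, hZ2, hx, hy, hm⟩ ⟨Z', hZ1', hZ2', hy', hz, hm'⟩
    exact ⟨Z ∪ Z', hZ1.union hZ1', hZ2.union y hy hy' hZ2', Or.inl hx, Or.inr hz,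
      fun h => h.elim hm hm'⟩

lemma Separated.isClosed_seg (H : Separated X) (a b : X) : IsClosed (seg a b) := by
  rw [← isOpen_compl_iff, isOpen_iff_mem_nhds]
  intro t ht
  obtain ⟨Z, hZ, hZ', ha, hb, htZ⟩ := H.exists_closed_preconnected ht
  filter_upwards [hZ.isOpen_compl.mem_nhds htZ] with s hs hs'
  exact hs (hs' Z hZ' ha hb)

/-- The first-point projection onto a segment. -/
lemma Separated.exists_projection (H : Separated X) {a b q : X} (hq : q ∉ seg a b) :
    ∃ m ∈ seg a b, ∀ w ∈ seg a b, m ∈ seg q w := by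
  set O := connectedComponentIn (seg a b)ᶜ q with hO
  have hqO : q ∈ O := mem_connectedComponentIn hq
  obtain ⟨m, hmO, hm⟩ := closure_connectedComponentIn_inter_nonempty (H.isClosed_seg a b)
    ⟨a, left_mem_seg a b⟩ hq
  have huniq : ∀ m' ∈ closure O, m' ∈ seg a b → m' = m := by
    intro m' hm'O hm'
    by_contra hne
    obtain ⟨u, hu, hum', hum⟩ := H m' m hne
    have hpre : IsPreconnected (insert m' (insert m O)) :=
      isPreconnected_connectedComponentIn.subset_closure
        ((subset_insert _ _).trans (subset_insert _ _))
        (insert_subset hm'O (insert_subset hmO subset_closure))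
    have huO : u ∈ O := ((hu _ hpre (mem_insert _ _) (mem_insert_of_mem _ (mem_insert _ _))
      ).resolve_left hum').resolve_left hum
    exact connectedComponentIn_subset _ _ huO (seg_subset hm' hm hu)
  refine ⟨m, hm, fun w hw => ?_⟩
  by_contra hmw
  obtain ⟨Z, hZ, hZ', hqZ, hwZ, hmZ⟩ := H.exists_closed_preconnected hmw
  obtain ⟨O', hO'Z, hO', hqO', hdis, m', hm'O', hm'⟩ :=
    exists_preconnected_bump hZ hZ' (H.isClosed_seg a b) hqZ hq ⟨w, hwZ, hw⟩
  have hsub : O' ⊆ O := hO'.subset_connectedComponentIn hqO'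
    (disjoint_left.1 hdis)
  have := huniq m' (closure_mono hsub hm'O') hm'
  subst this
  exact hmZ (closure_minimal hO'Z hZ hm'O')

lemma exists_seg_subset [Nontrivial X] {U : Set X} (hU : IsOpen U)
    (hne : U.Nonempty) : ∃ x y, x ≠ y ∧ seg x y ⊆ U := by
  by_cases hF : (Uᶜ).Nonempty
  · obtain ⟨q, hq⟩ := hne
    obtain ⟨O, -, hO, hqO, hdis, m, hm, hmF⟩ := exists_preconnected_bump isClosed_univ
      isPreconnected_univ hU.isClosed_compl (mem_univ q) (not_not.2 hq) (by simpa using hF)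
    have hOU : O ⊆ U := disjoint_compl_right_iff_subset.1 hdis
    have : ∃ y ∈ O, y ≠ q := by
      by_contra! h
      have : O ⊆ {q} := h
      have := closure_minimal this isClosed_singleton hm
      exact hmF (this ▸ hq)
    obtain ⟨y, hy, hyq⟩ := this
    exact ⟨q, y, hyq.symm, fun t ht => hOU (ht O hO hqO hy)⟩
  · rw [not_nonempty_iff_eq_empty, compl_empty_iff] at hF
    obtain ⟨x, y, hxy⟩ := exists_pair_ne X
    exact ⟨x, y, hxy, hF ▸ subset_univ _⟩

end Topology

/-- The interior points of the segment from `a` to `b` at which something branches off. -/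
def branchPoints {X : Type*} [TopologicalSpace X] (a b : X) : Set X :=
  {t | t ∈ seg a b ∧ t ≠ a ∧ t ≠ b ∧ ∃ q, q ≠ t ∧ t ∈ seg q a ∧ t ∈ seg q b}

lemma branchPoints_comm {X : Type*} [TopologicalSpace X] (a b : X) :
    branchPoints a b = branchPoints b a := by
  have key : ∀ a b : X, branchPoints a b ⊆ branchPoints b a :=
    fun a b t ⟨h1, h2, h3, q, h4, h5, h6⟩ => ⟨seg_comm a b ▸ h1, h3, h2, q, h4, h6, h5⟩
  exact (key a b).antisymm (key b a)

lemma mem_comp_or_mem_comp {X : Type*} [TopologicalSpace X] {a b t s : X} (hB : branchPoints a b = ∅)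
    (ht : t ∈ seg a b \ {a, b}) (hs : s ≠ t) : s ∈ comp t a ∨ s ∈ comp t b := by
  by_contra! h
  have h1 : t ∈ seg s a := seg_comm a s ▸ mem_seg_iff.2 h.1
  have h2 : t ∈ seg s b := seg_comm b s ▸ mem_seg_iff.2 h.2
  have h3 := ht.2
  simp only [mem_insert_iff, mem_singleton_iff, not_or] at h3
  have : t ∈ branchPoints a b := ⟨ht.1, h3.1, h3.2, s, hs, h1, h2⟩
  rw [hB] at this
  exact this

section FreeSegment

variable {X : Type*} [TopologicalSpace X] [CompactSpace X] [T2Space X] [ConnectedSpace X]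

lemma mem_comp_left {a b t s : X} (ht : t ∈ seg a b) (hs : s ∈ comp t b) : t ∈ comp s a := by
  have hst : s ≠ t := fun e => notMem_comp t b (e ▸ hs)
  have h1 : t ∉ seg s b := fun h => mem_comp_iff.1 hs (seg_comm s b ▸ h)
  have h2 : t ∈ seg a s := (seg_subset_union a s b ht).resolve_right h1
  exact mem_comp_iff.2 fun h =>
    hst (seg_antisymm (seg_comm a t ▸ h) (seg_comm a s ▸ h2))

lemma comp_subset_comp {a b t s : X} (ht : t ∈ seg a b) (hs : s ∈ seg a b)
    (hst : s ∈ comp t b) : comp s b ⊆ comp t b := by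
  by_cases hb : b = s
  · subst hb
    simp [comp_self]
  · exact subset_comp (isPreconnected_comp s b) (mem_comp_self hb)
      (disjoint_left.1 (disjoint_comp hs) (mem_comp_left ht hst))

/-- Without branch points, the open segment is an open subset of the dendrite. -/
lemma Separated.comp_inter_comp (H : Separated X) {a b : X} (hB : branchPoints a b = ∅) :
    comp a b ∩ comp b a = seg a b \ {a, b} := by
  ext q
  constructor
  · rintro ⟨hqa, hqb⟩
    have hqa' : q ≠ a := fun e => notMem_comp a b (e ▸ hqa)
    have hqb' : q ≠ b := fun e => notMem_comp b a (e ▸ hqb)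
    refine ⟨?_, by simp [hqa', hqb']⟩
    by_contra hq
    obtain ⟨m, hm, hmw⟩ := H.exists_projection hq
    have h1 := hmw a (left_mem_seg a b)
    have h2 := hmw b (right_mem_seg a b)
    have hma : m ≠ a := by
      rintro rfl
      exact mem_comp_iff.1 hqa (seg_comm q b ▸ h2)
    have hmb : m ≠ b := by
      rintro rfl
      exact mem_comp_iff.1 hqb (seg_comm q a ▸ h1)
    have : m ∈ branchPoints a b := ⟨hm, hma, hmb, q, fun e => hq (e ▸ hm), h1, h2⟩
    rw [hB] at this
    exact this
  · rintro ⟨hq, hqab⟩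
    simp only [mem_insert_iff, mem_singleton_iff, not_or] at hqab
    constructor
    · exact mem_comp_iff.2 fun h => hqab.1 (seg_antisymm (seg_comm b q ▸ h) hq).symm
    · exact mem_comp_iff.2 fun h =>
        hqab.2 (seg_antisymm (seg_comm a q ▸ h) (seg_comm a b ▸ hq)).symm

lemma Separated.isOpen_inner (H : Separated X) {a b : X} (hB : branchPoints a b = ∅) :
    IsOpen (seg a b \ {a, b}) := by
  rw [← H.comp_inter_comp hB]
  exact (H.isOpen_comp a b).inter (H.isOpen_comp b a)

/-- A segment without branch points cannot be split into two relatively open pieces. -/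
lemma Separated.not_split (H : Separated X) {a b p q : X} {P Q : Set X}
    (hB : branchPoints a b = ∅) (hP : IsOpen P) (hQ : IsOpen Q) (hPQ : Disjoint P Q)
    (hJ : P ∪ Q = seg a b \ {a, b}) (hp : p ∈ P) (hq : q ∈ Q) (hpq : q ∈ comp p b) : False := by
  have hpJ : p ∈ seg a b \ {a, b} := hJ ▸ Or.inl hp
  have hqJ : q ∈ seg a b \ {a, b} := hJ ▸ Or.inr hq
  have hqp : p ∈ comp q a := mem_comp_left hpJ.1 hpq
  have hp' := hpJ.2
  have hq' := hqJ.2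
  simp only [mem_insert_iff, mem_singleton_iff, not_or] at hp' hq'
  have hpd := disjoint_left.1 (disjoint_comp hpJ.1)
  have hqd := disjoint_left.1 (disjoint_comp hqJ.1)
  have hsub := comp_subset_comp hpJ.1 hqJ.1 hpq
  have hG1 : IsOpen (comp p a ∪ (P ∩ comp q a)) :=
    (H.isOpen_comp p a).union (hP.inter (H.isOpen_comp q a))
  have hG2 : IsOpen (comp q b ∪ (Q ∩ comp p b)) :=
    (H.isOpen_comp q b).union (hQ.inter (H.isOpen_comp p b))
  have hcover : (univ : Set X) ⊆ (comp p a ∪ (P ∩ comp q a)) ∪ (comp q b ∪ (Q ∩ comp p b)) := by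
    intro x _
    by_cases hxp : x = p
    · exact Or.inl (Or.inr (by rw [hxp]; exact ⟨hp, hqp⟩))
    by_cases hxq : x = q
    · exact Or.inr (Or.inr (by rw [hxq]; exact ⟨hq, hpq⟩))
    rcases mem_comp_or_mem_comp hB hpJ hxp with h1 | h1
    · exact Or.inl (Or.inl h1)
    rcases mem_comp_or_mem_comp hB hqJ hxq with h2 | h2
    swap
    · exact Or.inr (Or.inl h2)
    have hxJ : x ∈ P ∪ Q := by
      rw [hJ, ← H.comp_inter_comp hB]
      exact ⟨subset_comp (isPreconnected_comp p b) (mem_comp_self (Ne.symm hp'.2))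
        (notMem_comp_of_mem_seg hpJ.1) h1,
        subset_comp (isPreconnected_comp q a) (mem_comp_self (Ne.symm hq'.1))
        (notMem_comp_of_mem_seg (seg_comm a b ▸ hqJ.1)) h2⟩
    rcases hxJ with h | h
    · exact Or.inl (Or.inr ⟨h, h2⟩)
    · exact Or.inr (Or.inr ⟨h, h1⟩)
  obtain ⟨x, -, hx1, hx2⟩ := isPreconnected_univ _ _ hG1 hG2 hcover
    ⟨p, mem_univ p, Or.inr ⟨hp, hqp⟩⟩ ⟨q, mem_univ q, Or.inr ⟨hq, hpq⟩⟩
  rcases hx1 with hx1 | hx1 <;> rcases hx2 with hx2 | hx2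
  · exact hpd hx1 (hsub hx2)
  · exact hpd hx1 hx2.2
  · exact hqd hx1.2 hx2
  · exact disjoint_left.1 hPQ hx1.1 hx2.1

/-- A point `y` beyond `t` can be separated from `t` by a point of the free segment. -/
lemma Separated.exists_between (H : Separated X) {a b t y : X} (hB : branchPoints a b = ∅)
    (ht : t ∈ seg a b \ {a, b}) (hy : y ∈ comp t b) :
    ∃ u ∈ seg a b \ {a, b}, u ∈ comp t b ∧ y ∈ comp u b := by
  have ht' := ht.2
  simp only [mem_insert_iff, mem_singleton_iff, not_or] at ht'
  have key : ∀ y ∈ comp t b, y ∈ seg a b →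
      ∃ u ∈ seg a b \ {a, b}, u ∈ comp t b ∧ y ∈ insert b (comp u b) := by
    intro y hy hyJ
    have hyt : t ≠ y := fun e => notMem_comp t b (e ▸ hy)
    obtain ⟨u, hu, hut, huy⟩ := H t y hyt
    have hutb : u ∈ comp t b := (hu _ (isPreconnected_insert_comp t b) (mem_insert _ _)
      (mem_insert_of_mem _ hy)).resolve_left hut
    have huJ : u ∈ seg a b := seg_subset ht.1 hyJ hu
    have hytb : y ∈ seg t b := by
      refine (seg_subset_union a t b hyJ).resolve_left fun h => ?_
      exact mem_comp_iff.1 (mem_comp_left ht.1 hy) h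
    have hub : u ≠ b := by
      rintro rfl
      exact huy (seg_antisymm (seg_comm t y ▸ hu) (seg_comm t u ▸ hytb))
    have hua : u ≠ a := by
      rintro rfl
      exact notMem_comp_of_mem_seg ht.1 hutb
    refine ⟨u, ⟨huJ, by simp [hua, hub]⟩, hutb, mem_insert_of_mem _ (mem_comp_iff.2 fun h => ?_)⟩
    exact huy (seg_inter_seg hytb hu (seg_comm b y ▸ h))
  by_cases hyJ : y ∈ seg a b
  · obtain ⟨u, hu, hut, hyu⟩ := key y hy hyJ
    refine ⟨u, hu, hut, hyu.elim (fun e => ?_) id⟩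
    rw [e]
    refine mem_comp_self fun e' => ?_
    have := hu.2
    simp [e'] at this
  · obtain ⟨u, hu, hut, -⟩ := key b (mem_comp_self (Ne.symm ht'.2)) (right_mem_seg a b)
    refine ⟨u, hu, hut, mem_comp_iff.2 fun h => ?_⟩
    have hu' := hu.2
    simp only [mem_insert_iff, mem_singleton_iff, not_or] at hu'
    obtain ⟨m, hm, hmw⟩ := H.exists_projection hyJ
    have hmb : m = b := by
      by_contra hmb
      have hma : m ≠ a := by
        rintro rfl
        have := hmw b (right_mem_seg m b)
        exact notMem_comp_of_mem_seg ht.1 (this _ (isPreconnected_comp t b) hy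
          (mem_comp_self (Ne.symm ht'.2)))
      have : m ∈ branchPoints a b := ⟨hm, hma, hmb, y, fun e => hyJ (e ▸ hm),
        hmw a (left_mem_seg a b), hmw b (right_mem_seg a b)⟩
      rw [hB] at this
      exact this
    subst hmb
    exact hu'.2 (seg_antisymm (seg_comm m y ▸ h) (seg_comm y u ▸ hmw u hu.1))

lemma Separated.isOpen_moves_right (H : Separated X) {a b : X} (hB : branchPoints a b = ∅)
    {g : X → X} (hg : Continuous g) :
    IsOpen {t | t ∈ seg a b \ {a, b} ∧ g t ∈ comp t b} := by
  rw [isOpen_iff_mem_nhds]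
  rintro t ⟨ht, hgt⟩
  obtain ⟨u, hu, hut, hyu⟩ := H.exists_between hB ht hgt
  filter_upwards [(H.isOpen_inner hB).mem_nhds ht,
    (H.isOpen_comp u a).mem_nhds (mem_comp_left ht.1 hut),
    ((H.isOpen_comp u b).preimage hg).mem_nhds hyu] with s hs hsu hgs
  refine ⟨hs, comp_subset_comp hs.1 hu.1 ?_ hgs⟩
  exact mem_comp_left (seg_comm a b ▸ hu.1) hsu

lemma Separated.not_moves_right (H : Separated X) {a b : X} (hB : branchPoints a b = ∅) {g : X → X}
    {K : Set X} (hK : IsCompact K) (hne : K.Nonempty) (hKJ : K ⊆ seg a b \ {a, b})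
    (hgK : g '' K = K) : ¬ ∀ t ∈ K, g t ∈ comp t b := by
  intro h
  have : Nonempty K := hne.to_subtype
  obtain ⟨k, hk⟩ := hK.elim_directed_cover (fun k : K => comp (k : X) b)
    (fun k => H.isOpen_comp _ _)
    (by
      intro x hx
      rw [← hgK] at hx
      obtain ⟨k, hk, rfl⟩ := hx
      exact mem_iUnion.2 ⟨⟨k, hk⟩, h k hk⟩)
    (by
      intro k k'
      by_cases hkk : (k' : X) = k
      · exact ⟨k, subset_rfl, by simp only [hkk]; exact subset_rfl⟩
      rcases mem_comp_or_mem_comp hB (hKJ k.2) hkk with h1 | h1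
      · refine ⟨k', comp_subset_comp (hKJ k'.2).1 (hKJ k.2).1 ?_, subset_rfl⟩
        exact mem_comp_left (seg_comm a b ▸ (hKJ k.2).1) h1
      · exact ⟨k, subset_rfl, comp_subset_comp (hKJ k.2).1 (hKJ k'.2).1 h1⟩)
  exact notMem_comp _ _ (hk k.2)

lemma Separated.exists_fixedPoint (H : Separated X) {a b : X} (hB : branchPoints a b = ∅)
    {g : X → X} (hg : Continuous g) {K : Set X} (hK : IsCompact K) (hne : K.Nonempty)
    (hKJ : K ⊆ seg a b \ {a, b}) (hgK : g '' K = K) : ∃ t ∈ seg a b \ {a, b}, g t = t := by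
  by_contra! hfix
  have hB' : branchPoints b a = ∅ := branchPoints_comm a b ▸ hB
  have hJ' : seg b a \ {b, a} = seg a b \ {a, b} := by rw [seg_comm, pair_comm]
  set P := {t | t ∈ seg a b \ {a, b} ∧ g t ∈ comp t b} with hP
  set Q := {t | t ∈ seg b a \ {b, a} ∧ g t ∈ comp t a} with hQ
  have hPo : IsOpen P := H.isOpen_moves_right hB hg
  have hQo : IsOpen Q := H.isOpen_moves_right hB' hg
  have hPQ : Disjoint P Q := disjoint_left.2 fun t ht ht' =>
    disjoint_left.1 (disjoint_comp ht.1.1) ht'.2 ht.2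
  have hJ : P ∪ Q = seg a b \ {a, b} := by
    ext t
    constructor
    · rintro (ht | ht)
      exacts [ht.1, hJ' ▸ ht.1]
    · intro ht
      rcases mem_comp_or_mem_comp hB ht (hfix t ht) with h | h
      exacts [Or.inr ⟨hJ'.symm ▸ ht, h⟩, Or.inl ⟨ht, h⟩]
  by_cases hPe : P.Nonempty
  · by_cases hQe : Q.Nonempty
    · obtain ⟨p, hp⟩ := hPe
      obtain ⟨q, hq⟩ := hQe
      have hne : q ≠ p := fun e => disjoint_left.1 hPQ hp (e ▸ hq)
      rcases mem_comp_or_mem_comp hB hp.1 hne with h | h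
      · exact H.not_split hB' hPo hQo hPQ (hJ.trans hJ'.symm) hp hq h
      · exact H.not_split hB hPo hQo hPQ hJ hp hq h
    · rw [not_nonempty_iff_eq_empty] at hQe
      rw [hQe, union_empty] at hJ
      exact H.not_moves_right hB hK hne hKJ hgK fun t ht => (hJ ▸ hKJ ht : t ∈ P).2
  · rw [not_nonempty_iff_eq_empty] at hPe
    rw [hPe, empty_union] at hJ
    exact H.not_moves_right hB' hK hne (hJ'.symm ▸ hKJ) hgK fun t ht => (hJ ▸ hKJ ht : t ∈ Q).2

end FreeSegment

section Existence

variable {X : Type*} [MetricSpace X] [CompactSpace X] [ConnectedSpace X]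

/-- If no component of the complement of a point lies in the open set `U`, then a segment inside
`U` has only finitely many branch points. -/
lemma Separated.finite_branchPoints (H : Separated X) {U : Set X} (hU : IsOpen U) {x y : X}
    (hxy : seg x y ⊆ U) (hno : ∀ p q : X, q ≠ p → ¬ comp p q ⊆ U) :
    (branchPoints x y).Finite := by
  by_contra hinf
  have hinf : (branchPoints x y).Infinite := hinf
  have hc : ∀ t : branchPoints x y, ∃ c, c ∉ U ∧ (t : X) ∈ seg c x ∧ (t : X) ∈ seg c y := by
    rintro ⟨t, ht, htx, hty, q, hqt, h1, h2⟩
    obtain ⟨c, hc, hcU⟩ := not_subset.1 (hno t q hqt)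
    refine ⟨c, hcU, ?_, ?_⟩
    · rw [mem_seg_iff] at h1 ⊢
      rwa [← comp_eq hc]
    · rw [mem_seg_iff] at h2 ⊢
      rwa [← comp_eq hc]
  choose c hcU hcx hcy using hc
  let t : ℕ ↪ branchPoints x y := hinf.natEmbedding
  obtain ⟨⟨p, d⟩, φ, hφ, hlim⟩ := CompactSpace.tendsto_subseq
    (fun n => (((t n : X), c (t n)) : X × X))
  have hlim1 : Tendsto (fun n => (t (φ n) : X)) atTop (𝓝 p) :=
    (continuous_fst.tendsto (p, d)).comp hlim
  have hlim2 : Tendsto (fun n => c (t (φ n))) atTop (𝓝 d) :=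
    (continuous_snd.tendsto (p, d)).comp hlim
  have hp : p ∈ U := hxy ((H.isClosed_seg x y).mem_of_tendsto hlim1
    (Eventually.of_forall fun n => (t (φ n)).2.1))
  have hd : d ∈ Uᶜ := hU.isClosed_compl.mem_of_tendsto hlim2
    (Eventually.of_forall fun n => hcU _)
  have hpd : p ≠ d := fun e => hd (e ▸ hp)
  obtain ⟨z, hz, hzp, hzd⟩ := H p d hpd
  have hev : ∀ᶠ n in atTop, z ∈ seg (t (φ n) : X) (c (t (φ n))) := by
    filter_upwards [hlim1 ((H.isOpen_comp z p).mem_nhds (mem_comp_self hzp.symm)),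
      hlim2 ((H.isOpen_comp z d).mem_nhds (mem_comp_self hzd.symm))] with n h1 h2
    rw [mem_seg_iff]
    intro h3
    refine mem_seg_iff.1 hz ?_
    rw [comp_eq h1, comp_eq h3, ← comp_eq h2]
    exact mem_comp_self hzd.symm
  obtain ⟨N, hN⟩ := eventually_atTop.1 hev
  have hne : t (φ N) ≠ t (φ (N + 1)) := fun e =>
    (hφ (Nat.lt_succ_self N)).ne (t.injective e)
  have h1 := hN N le_rfl
  have h2 := hN (N + 1) (Nat.le_succ N)
  have hout : ∀ s s' : branchPoints x y, (s' : X) ∉ comp (s : X) (c s) := by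
    intro s s' h
    exact s'.2.1 _ (isPreconnected_compl_comp (s : X) (c s)) (mem_seg_iff.1 (hcx s))
      (mem_seg_iff.1 (hcy s)) h
  generalize t (φ N) = s at *
  generalize t (φ (N + 1)) = s' at *
  have hss' : (s : X) ≠ s' := fun e => hne (Subtype.ext e)
  have h3 := h1 _ (isPreconnected_insert_comp (s : X) (c s)) (mem_insert _ _)
    (mem_insert_comp_self _ _)
  have h4 := h2 _ (isPreconnected_insert_comp (s' : X) (c s')) (mem_insert _ _)
    (mem_insert_comp_self _ _)
  have hs' : (s' : X) ∉ insert (s : X) (comp (s : X) (c s)) := by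
    rintro (h | h)
    exacts [hss' h.symm, hout s s' h]
  have hzs' : z ∈ comp (s' : X) (c s') :=
    h4.resolve_left fun e => hs' (e ▸ h3)
  refine hout s' s ?_
  rw [comp_eq hzs']
  exact subset_comp (isPreconnected_insert_comp (s : X) (c s)) h3 hs' (mem_insert _ _)

lemma branchPoints_subset {x y t : X} (ht : t ∈ branchPoints x y) :
    branchPoints x t ⊆ branchPoints x y \ {t} := by
  rintro s ⟨hs, hsx, hst, w, hws, hwx, hwt⟩
  refine ⟨⟨seg_subset (left_mem_seg x y) ht.1 hs, hsx, ?_, w, hws, hwx, ?_⟩, hst⟩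
  · rintro rfl
    exact hst (seg_antisymm (seg_comm x t ▸ hs) (seg_comm x s ▸ ht.1))
  · refine (seg_subset_union w y t hwt).resolve_right fun h => ?_
    exact hst (seg_inter_seg ht.1 hs (seg_comm y t ▸ h))

lemma exists_branchPoints_eq_empty {x y : X} (hxy : x ≠ y) (hfin : (branchPoints x y).Finite) :
    ∃ z, x ≠ z ∧ seg x z ⊆ seg x y ∧ branchPoints x z = ∅ := by
  induction h : (branchPoints x y).ncard using Nat.strong_induction_on generalizing y with
  | _ n ih =>
    by_cases hB : branchPoints x y = ∅
    · exact ⟨y, hxy, subset_rfl, hB⟩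
    · obtain ⟨t, ht⟩ := nonempty_iff_ne_empty.2 hB
      have hsub := branchPoints_subset ht
      have hlt : (branchPoints x t).ncard < n := by
        rw [← h]
        exact ncard_lt_ncard (hsub.trans_ssubset (sdiff_singleton_ssubset.2 ht)) hfin
      obtain ⟨z, hz, hsz, hBz⟩ := ih _ hlt ht.2.1.symm (hfin.subset (hsub.trans sdiff_subset)) rfl
      exact ⟨z, hz, hsz.trans (seg_subset (left_mem_seg x y) ht.1), hBz⟩

lemma Separated.exists_free_segment [Nontrivial X] (H : Separated X) {U : Set X} (hU : IsOpen U)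
    (hne : U.Nonempty) (hno : ∀ p q : X, q ≠ p → ¬ comp p q ⊆ U) :
    ∃ a b, a ≠ b ∧ seg a b ⊆ U ∧ branchPoints a b = ∅ := by
  obtain ⟨x, y, hxy, hsub⟩ := exists_seg_subset hU hne
  obtain ⟨z, hz, hsz, hB⟩ :=
    exists_branchPoints_eq_empty hxy (H.finite_branchPoints hU hsub hno)
  exact ⟨x, z, hz, hsz.trans hsub, hB⟩

/-- A point contained in arbitrarily small components of complements of points is an endpoint. -/
lemma isEndpointOf_of_small_comp {e : X}
    (h : ∀ n : ℕ, ∃ p q : X, e ∈ comp p q ∧ ∀ z ∈ comp p q, dist z e < 1 / (n + 1)) :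
    IsEndpointOf X e := by
  choose p q he hd using h
  have hsmall : ∀ w : X, w ≠ e → ∃ N : ℕ, ∀ n ≥ N, w ∉ comp (p n) (q n) := by
    intro w hw
    obtain ⟨N, hN⟩ := exists_nat_one_div_lt (dist_pos.2 hw)
    refine ⟨N, fun n hn hwn => ?_⟩
    have h1 := hd n w hwn
    have h2 : (1 : ℝ) / (n + 1) ≤ 1 / (N + 1) := Nat.one_div_le_one_div hn
    linarith
  unfold IsEndpointOf
  by_cases hemp : ({e}ᶜ : Set X) = ∅
  · rw [hemp]
    exact isPreconnected_empty
  obtain ⟨w, hw⟩ := nonempty_iff_ne_empty.2 hemp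
  obtain ⟨N, hN⟩ := hsmall w hw
  have : ({e}ᶜ : Set X) = ⋃ n : ℕ, (comp (p (N + n)) (q (N + n)))ᶜ := by
    ext z
    simp only [mem_compl_iff, mem_singleton_iff, mem_iUnion]
    constructor
    · intro hz
      obtain ⟨M, hM⟩ := hsmall z hz
      exact ⟨M, hM _ (Nat.le_add_left M N)⟩
    · rintro ⟨n, hn⟩ rfl
      exact hn (he _)
  rw [this]
  exact isPreconnected_iUnion ⟨w, mem_iInter.2 fun n => hN _ (Nat.le_add_right N n)⟩
    fun n => isPreconnected_compl_comp _ _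

/-- If every open subset of `U` contains a component of the complement of a point, then `U`
contains an endpoint outside any prescribed countable set. -/
lemma Separated.exists_endpoint [Nontrivial X] (H : Separated X) {U : Set X} (hU : IsOpen U)
    (hne : U.Nonempty)
    (hbr : ∀ V ⊆ U, IsOpen V → V.Nonempty → ∃ p q : X, q ≠ p ∧ comp p q ⊆ V)
    {D : Set X} (hD : D.Countable) : ∃ e ∈ U, e ∉ D ∧ IsEndpointOf X e := by
  let G : ℕ → Set X := fun n =>
    ⋃₀ {V | ∃ p q : X, V = comp p q ∧ ∀ z ∈ V, ∀ w ∈ V, dist z w < 1 / (n + 1 : ℝ)} ∪ (closure U)ᶜ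
  have hGo : ∀ n, IsOpen (G n) := by
    intro n
    refine (isOpen_sUnion ?_).union isClosed_closure.isOpen_compl
    rintro _ ⟨p, q, rfl, -⟩
    exact H.isOpen_comp p q
  have hGd : ∀ n, Dense (G n) := by
    intro n
    rw [dense_iff_inter_open]
    intro W hW hWne
    by_cases hWU : (W ∩ U).Nonempty
    · obtain ⟨x, hxW, hxU⟩ := hWU
      have hpos : (0 : ℝ) < 1 / (n + 1) / 2 := by positivity
      obtain ⟨p, q, hqp, hpq⟩ := hbr ((W ∩ U) ∩ Metric.ball x (1 / (n + 1) / 2))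
        (inter_subset_left.trans inter_subset_right) ((hW.inter hU).inter Metric.isOpen_ball)
        ⟨x, ⟨hxW, hxU⟩, Metric.mem_ball_self hpos⟩
      refine ⟨q, (hpq (mem_comp_self hqp)).1.1, Or.inl ⟨_, ⟨p, q, rfl, ?_⟩, mem_comp_self hqp⟩⟩
      intro z hz w hw
      have h1 := Metric.mem_ball.1 (hpq hz).2
      have h2 := Metric.mem_ball'.1 (hpq hw).2
      linarith [dist_triangle z x w]
    · obtain ⟨x, hx⟩ := hWne
      refine ⟨x, hx, Or.inr fun hxU => hWU ?_⟩
      exact mem_closure_iff.1 hxU W hW hx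
  let S : Set (Set X) := range G ∪ (fun d => ({d}ᶜ : Set X)) '' D
  have hS : Dense (⋂₀ S) := by
    refine dense_sInter_of_isOpen ?_ ((countable_range G).union (hD.image _)) ?_
    · rintro _ (⟨n, rfl⟩ | ⟨d, -, rfl⟩)
      exacts [hGo n, isOpen_compl_singleton]
    · rintro _ (⟨n, rfl⟩ | ⟨d, -, rfl⟩)
      exacts [hGd n, dense_compl_singleton d]
  obtain ⟨e, heU, he⟩ := hS.inter_open_nonempty U hU hne
  refine ⟨e, heU, fun heD => he _ (Or.inr ⟨e, heD, rfl⟩) rfl, isEndpointOf_of_small_comp ?_⟩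
  intro n
  rcases he _ (Or.inl ⟨n, rfl⟩) with ⟨_, ⟨p, q, rfl, hd⟩, heV⟩ | h
  · exact ⟨p, q, heV, fun z hz => hd z hz e heV⟩
  · exact absurd (subset_closure heU) h

lemma Separated.exists_not_isEndpointOf [Nontrivial X] (H : Separated X) {U : Set X}
    (hU : IsOpen U) (hne : U.Nonempty) : ∃ t ∈ U, ¬ IsEndpointOf X t := by
  obtain ⟨x, y, hxy, hsub⟩ := exists_seg_subset hU hne
  obtain ⟨t, ht, htx, hty⟩ := H x y hxy
  exact ⟨t, hsub ht, fun h => ht _ h htx.symm hty.symm rfl⟩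

/-- Free segments are dense when the endpoint set is countable or closed. -/
lemma Separated.exists_free_segment_of_endpoints [Nontrivial X] (H : Separated X)
    (hE : ({p : X | IsEndpointOf X p}).Countable ∨ IsClosed {p : X | IsEndpointOf X p})
    {U : Set X} (hU : IsOpen U) (hne : U.Nonempty) :
    ∃ a b, a ≠ b ∧ seg a b ⊆ U ∧ branchPoints a b = ∅ := by
  by_contra hcon
  have hbr : ∀ V ⊆ U, IsOpen V → V.Nonempty → ∃ p q : X, q ≠ p ∧ comp p q ⊆ V := by
    intro V hVU hV hVne
    by_contra! hno
    obtain ⟨a, b, hab, hsub, hB⟩ := H.exists_free_segment hV hVne hno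
    exact hcon ⟨a, b, hab, hsub.trans hVU, hB⟩
  rcases hE with hE | hE
  · obtain ⟨e, -, he, he'⟩ := H.exists_endpoint hU hne hbr hE
    exact he he'
  · obtain ⟨t, htU, ht⟩ := H.exists_not_isEndpointOf hU hne
    obtain ⟨e, ⟨heU, he⟩, -, he'⟩ := H.exists_endpoint (hU.inter hE.isOpen_compl) ⟨t, htU, ht⟩
      (fun V hV => hbr V (hV.trans inter_subset_left)) countable_empty
    exact he he'

end Existence

lemma coe_hyperMap_iterate {X : Type*} [TopologicalSpace X] {f : X → X} (hf : Continuous f)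
    (n : ℕ) (A : NonemptyCompacts X) : (((hyperMap hf)^[n] A : NonemptyCompacts X) : Set X) =
      f^[n] '' (A : Set X) := by
  induction n with
  | zero => simp
  | succ n ih =>
    rw [Function.iterate_succ_apply', Function.iterate_succ', image_comp, ← ih]
    rfl

end Dendrite

/-- On a dendrite with countable or closed endpoint set, density of the
periodic points of the induced hyperspace map implies density of the periodic points
of `f`. -/
theorem stmt17 {X : Type*} [MetricSpace X] [CompactSpace X] [ConnectedSpace X]
    (hD : IsDendrite X)
    (hE : ({p : X | IsEndpointOf X p}).Countable ∨ IsClosed {p : X | IsEndpointOf X p})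
    {f : X → X} (hf : Continuous f)
    (hper : Dense {A : NonemptyCompacts X | IsPeriodic (hyperMap hf) A}) :
    Dense {p : X | IsPeriodic f p} := by
  have := hD.1
  have H := Dendrite.separated_of_isDendrite hD
  rw [dense_iff_inter_open]
  intro U hU hne
  obtain ⟨a, b, hab, hsub, hB⟩ := H.exists_free_segment_of_endpoints hE hU hne
  obtain ⟨c, hc, hca, hcb⟩ := H a b hab
  have hJo := H.isOpen_inner hB
  obtain ⟨K, hKJ, n, hn, hKn⟩ := hper.inter_open_nonempty _
    (NonemptyCompacts.isOpen_subsets_of_isOpen hJo)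
    ⟨{c}, by simpa using ⟨hc, hca, hcb⟩⟩
  have hK : f^[n] '' (K : Set X) = K := by
    rw [← Dendrite.coe_hyperMap_iterate hf, hKn]
  obtain ⟨t, ht, hft⟩ := H.exists_fixedPoint hB (hf.iterate n) K.isCompact K.nonempty hKJ hK
  exact ⟨t, hsub ht.1, n, hn, hft⟩
end
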